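/- Let A⁽¹⁾, A⁽²⁾ ∈ ℂ^{n×n} be independent samples from the trace-normalised complex Wishart–Laguerre ensemble with parameters n, m, with eigenvalues λ₁⁽¹⁾ ≥ … ≥ λ_n⁽¹⁾ and λ₁⁽²⁾ ≥ … ≥ λ_n⁽²⁾, and let Π = min_{1 ≤ k ≤ n} (λ_k⁽¹⁾ + λ_{k+1}⁽¹⁾ + … + λ_n⁽¹⁾)/(λ_k⁽²⁾ + λ_{k+1}⁽²⁾ + … + λ_n⁽²⁾). For every ε > 0 and δ > 0 there exists a constant C(ε,δ) > 0 such that if m ≥ n + C(ε,δ)·√(n·log n) and n ≥ C(ε,δ), then P[Π < 1 − ε] ≤ δ. -/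

import Mathlib

open MeasureTheory ProbabilityTheory Filter Topology

noncomputable section

instance {n m α : Type*} [MeasurableSpace α] : MeasurableSpace (Matrix n m α) :=
  inferInstanceAs (MeasurableSpace (n → m → α))

/-- Standard complex Gaussian: `Z = X + iY` with `X, Y` independent real Gaussians of mean 0
and variance 1/2, so that `E[|Z|²] = 1`. -/
def stdCGaussian : Measure ℂ :=
  ((gaussianReal 0 (1/2)).prod (gaussianReal 0 (1/2))).map
    (fun p : ℝ × ℝ => (p.1 : ℂ) + p.2 * Complex.I)

/-- The law of an `n × m` matrix with i.i.d. standard complex Gaussian entries. -/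
def gaussMatrix (n m : ℕ) : Measure (Matrix (Fin n) (Fin m) ℂ) :=
  Measure.pi fun _ : Fin n => Measure.pi fun _ : Fin m => stdCGaussian

/-- The complex Wishart--Laguerre ensemble with parameters `n, m`: the law of `G Gᴴ` where
`G` is an `n × m` matrix with i.i.d. standard complex Gaussian entries. -/
def wishart (n m : ℕ) : Measure (Matrix (Fin n) (Fin n) ℂ) :=
  (gaussMatrix n m).map fun G => G * G.conjTranspose

/-- The trace-normalised complex Wishart--Laguerre ensemble: the law of `M / tr M` where `M`
is sampled from the complex Wishart--Laguerre ensemble. -/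
def wishartNorm (n m : ℕ) : Measure (Matrix (Fin n) (Fin n) ℂ) :=
  (wishart n m).map fun M => (Matrix.trace M)⁻¹ • M

/-- The (real) eigenvalues of a Hermitian matrix (junk value `0` if not Hermitian). -/
def eigs {n : ℕ} (M : Matrix (Fin n) (Fin n) ℂ) : Fin n → ℝ :=
  if h : M.IsHermitian then h.eigenvalues else 0

/-- The decreasing rearrangement of a tuple of reals. -/
def sortDesc {n : ℕ} (v : Fin n → ℝ) : Fin n → ℝ :=
  fun i => v (Tuple.sort v i.rev)

/-- `tailSum v k = v k + v (k+1) + ... + v (n-1)` (so with `v` sorted decreasingly and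
`k` the 0-indexed version of the 1-indexed index in the paper, this is `λ_k + ... + λ_n`). -/
def tailSum {n : ℕ} (v : Fin n → ℝ) (k : Fin n) : ℝ :=
  ∑ i ∈ Finset.univ.filter (fun i => k ≤ i), v i

/-- The eigenvalues of `M`, sorted in decreasing order. -/
def eigsDesc {n : ℕ} (M : Matrix (Fin n) (Fin n) ℂ) : Fin n → ℝ := sortDesc (eigs M)

/-- `Π = min_{1 ≤ k ≤ n} (λ_k⁽¹⁾ + ... + λ_n⁽¹⁾)/(λ_k⁽²⁾ + ... + λ_n⁽²⁾)` for the decreasingly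
sorted eigenvalues of `M₁` and `M₂`. -/
def PiRatio {n : ℕ} (M₁ M₂ : Matrix (Fin n) (Fin n) ℂ) : ℝ :=
  ⨅ k : Fin n, tailSum (eigsDesc M₁) k / tailSum (eigsDesc M₂) k

theorem absolutelyContinuous_pi_const {ι : Type*} [Fintype ι] {α : Type*} [MeasurableSpace α]
    {μ ν : Measure α} [SigmaFinite μ] [SigmaFinite ν] (h : μ ≪ ν) :
    (Measure.pi fun _ : ι => μ) ≪ Measure.pi fun _ : ι => ν := by
  refine Fintype.induction_empty_option
    (P := fun ι [Fintype ι] => (Measure.pi fun _ : ι => μ) ≪ Measure.pi fun _ : ι => ν)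
    ?_ ?_ ?_ ι
  · intro ι κ _ e hι
    let _ : Fintype ι := Fintype.ofEquiv κ e.symm
    rw [← Measure.pi_map_piCongrLeft e (fun _ => μ), ← Measure.pi_map_piCongrLeft e (fun _ => ν)]
    refine Measure.AbsolutelyContinuous.map ?_ (MeasurableEquiv.measurable _)
    convert hι
  · rw [Measure.pi_of_empty (fun _ => μ), Measure.pi_of_empty (fun _ => ν)]
  · intro ι _ hι
    rw [← Measure.pi_map_piOptionEquivProd (fun _ : Option ι => μ),
      ← Measure.pi_map_piOptionEquivProd (fun _ : Option ι => ν)]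
    exact (hι.prod h).map (MeasurableEquiv.measurable _)

theorem stdGaussian_absolutelyContinuous (E : Type*) [NormedAddCommGroup E]
    [InnerProductSpace ℝ E] [FiniteDimensional ℝ E] [MeasurableSpace E] [BorelSpace E] :
    stdGaussian E ≪ volume := by
  have h : stdGaussian (EuclideanSpace ℝ (Fin (Module.finrank ℝ E))) ≪ volume := by
    rw [← map_pi_eq_stdGaussian, ← (PiLp.volume_preserving_toLp _).map_eq]
    exact (absolutelyContinuous_pi_const
      (gaussianReal_absolutelyContinuous 0 one_ne_zero)).map (by fun_prop)
  rw [← stdGaussian_map (stdOrthonormalBasis ℝ E).repr.symm,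
    ← (stdOrthonormalBasis ℝ E).repr.symm.measurePreserving.map_eq]
  exact h.map (by fun_prop)

section Poincare

variable {E : Type*} [NormedAddCommGroup E] [InnerProductSpace ℝ E] {f : E → ℝ} {K : NNReal}

theorem norm_rotation_sub_le (h : ℝ) (p : E × E) :
    ‖Real.cos h • p.1 + Real.sin h • p.2 - p.1‖ ≤ |h| * (‖p.1‖ + ‖p.2‖) := by
  have e : Real.cos h • p.1 + Real.sin h • p.2 - p.1 =
      (Real.cos h - 1) • p.1 + Real.sin h • p.2 := by module
  have h1 : |Real.cos h - 1| ≤ |h| := by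
    have := Real.abs_cos_sub_cos_le h 0
    simpa using this
  have h2 : |Real.sin h| ≤ |h| := Real.abs_sin_le_abs
  rw [e]
  refine (norm_add_le _ _).trans ?_
  rw [norm_smul, norm_smul, mul_add]
  gcongr
  · exact h1
  · exact h2

theorem tendsto_rotation_slope {x : E} (hx : DifferentiableAt ℝ f x) (y : E) :
    Tendsto (fun N : ℕ => ((N : ℝ) + 1) *
        (f (Real.cos (Real.pi / 2 / (N + 1)) • x + Real.sin (Real.pi / 2 / (N + 1)) • y) - f x))
      atTop (𝓝 (Real.pi / 2 * fderiv ℝ f x y)) := by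
  have hc : HasDerivAt (fun θ : ℝ => Real.cos θ • x + Real.sin θ • y) y 0 := by
    have h1 := ((Real.hasDerivAt_cos 0).smul_const x).add ((Real.hasDerivAt_sin 0).smul_const y)
    have h2 := h1
    simp only [Real.sin_zero, neg_zero, zero_smul, Real.cos_zero, one_smul, zero_add] at h2
    exact h2
  have hx' : HasFDerivAt f (fderiv ℝ f x) (Real.cos 0 • x + Real.sin 0 • y) := by
    simpa using hx.hasFDerivAt
  have h3 := hx'.comp_hasDerivAt (0 : ℝ) hc
  have h4 := h3.tendsto_slope
  have h5 : Tendsto (fun N : ℕ => Real.pi / 2 / ((N : ℝ) + 1)) atTop (𝓝[≠] 0) := by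
    refine tendsto_nhdsWithin_iff.2 ⟨?_, Eventually.of_forall fun N => ?_⟩
    · simpa [div_eq_mul_inv] using
        (tendsto_one_div_add_atTop_nhds_zero_nat (𝕜 := ℝ)).const_mul (Real.pi / 2)
    · have : (0 : ℝ) < Real.pi / 2 / ((N : ℝ) + 1) := by positivity
      exact this.ne'
  have h6 := (h4.comp h5).const_mul (Real.pi / 2)
  refine h6.congr fun N => ?_
  simp only [Function.comp_apply, slope_def_field, Real.cos_zero, one_smul, Real.sin_zero,
    zero_smul, add_zero, sub_zero]
  have : (N : ℝ) + 1 ≠ 0 := by positivity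
  field_simp

theorem lipschitz_rotation_bound (hf : LipschitzWith K f) (h : ℝ) (p : E × E) :
    |f (Real.cos h • p.1 + Real.sin h • p.2) - f p.1| ≤ K * (|h| * (‖p.1‖ + ‖p.2‖)) := by
  have := hf.dist_le_mul (Real.cos h • p.1 + Real.sin h • p.2) p.1
  rw [Real.dist_eq, dist_eq_norm] at this
  exact this.trans (by gcongr; exact norm_rotation_sub_le h p)

variable [FiniteDimensional ℝ E] [MeasurableSpace E] [BorelSpace E]

theorem memLp_two_of_lipschitz (hf : LipschitzWith K f) : MemLp f 2 (stdGaussian E) := by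
  have h1 : MemLp (fun x : E => |f 0| + K * ‖x‖) 2 (stdGaussian E) :=
    MemLp.add (memLp_const _)
      (MemLp.const_mul (IsGaussian.memLp_two_id (μ := stdGaussian E)).norm _)
  refine h1.mono (hf.continuous.aestronglyMeasurable (μ := stdGaussian E)) (ae_of_all _ fun x => ?_)
  have h2 := hf.dist_le_mul x 0
  rw [Real.dist_eq, dist_zero_right] at h2
  have h3 : |f x| ≤ |f x - f 0| + |f 0| := by simpa using abs_add_le (f x - f 0) (f 0)
  rw [Real.norm_eq_abs, Real.norm_eq_abs,
    abs_of_nonneg (by positivity : (0 : ℝ) ≤ |f 0| + K * ‖x‖)]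
  linarith

/-- The step of a discretised rotation has a law independent of the starting angle. -/
theorem integral_sq_rotation_step (hf : Continuous f) (θ h : ℝ) :
    ∫ p : E × E, (f (Real.cos (θ + h) • p.1 + Real.sin (θ + h) • p.2)
        - f (Real.cos θ • p.1 + Real.sin θ • p.2)) ^ 2 ∂(stdGaussian E).prod (stdGaussian E) =
      ∫ p : E × E, (f (Real.cos h • p.1 + Real.sin h • p.2) - f p.1) ^ 2
        ∂(stdGaussian E).prod (stdGaussian E) := by
  have hrot := IsGaussian.map_rotation_eq_self (μ := stdGaussian E) (by simp) θ
  conv_rhs => rw [← hrot]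
  rw [integral_map (ContinuousLinearMap.continuous _).aemeasurable
    (by fun_prop)]
  refine integral_congr_ae (ae_of_all _ fun p => ?_)
  simp only [ContinuousLinearMap.rotation_apply]
  congr 3
  rw [Real.cos_add, Real.sin_add]
  module

theorem integrable_norm_add_sq :
    Integrable (fun p : E × E => (‖p.1‖ + ‖p.2‖) ^ 2) ((stdGaussian E).prod (stdGaussian E)) := by
  have h1 : MemLp (fun p : E × E => ‖p.1‖ + ‖p.2‖) 2 ((stdGaussian E).prod (stdGaussian E)) := by
    refine MemLp.add ?_ ?_
    · exact ((IsGaussian.memLp_two_id (μ := stdGaussian E)).comp_fst (stdGaussian E)).norm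
    · exact ((IsGaussian.memLp_two_id (μ := stdGaussian E)).comp_snd (stdGaussian E)).norm
  exact h1.integrable_sq

theorem integral_sq_dual (L : StrongDual ℝ E) : ∫ y, (L y) ^ 2 ∂stdGaussian E = ‖L‖ ^ 2 := by
  rw [← variance_dual_stdGaussian, variance_eq_integral L.continuous.aemeasurable,
    integral_strongDual_stdGaussian]
  simp

theorem integral_sq_sub_le_of_lipschitz (hf : LipschitzWith K f) :
    ∫ p : E × E, (f p.2 - f p.1) ^ 2 ∂(stdGaussian E).prod (stdGaussian E) ≤
      (Real.pi / 2) ^ 2 * K ^ 2 := by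
  set F : ℕ → E × E → ℝ := fun N p => (((N : ℝ) + 1) *
        (f (Real.cos (Real.pi / 2 / (N + 1)) • p.1 + Real.sin (Real.pi / 2 / (N + 1)) • p.2)
          - f p.1)) ^ 2 with hF
  set G : E × E → ℝ := fun p => (Real.pi / 2 * fderiv ℝ f p.1 p.2) ^ 2 with hG
  have hfc := hf.continuous
  have hdiff : ∀ᵐ p ∂(stdGaussian E).prod (stdGaussian E), DifferentiableAt ℝ f p.1 := by
    have h1 : ∀ᵐ x ∂stdGaussian E, DifferentiableAt ℝ f x :=
      (stdGaussian_absolutelyContinuous E).ae_le hf.ae_differentiableAt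
    exact Measure.quasiMeasurePreserving_fst.ae h1
  have hlim : ∀ᵐ p ∂(stdGaussian E).prod (stdGaussian E),
      Tendsto (fun N => F N p) atTop (𝓝 (G p)) := by
    filter_upwards [hdiff] with p hp
    exact (tendsto_rotation_slope hp p.2).pow 2
  have hFm : ∀ N, AEStronglyMeasurable (F N) ((stdGaussian E).prod (stdGaussian E)) := fun N => by
    simp only [hF]; exact Continuous.aestronglyMeasurable (by fun_prop)
  have hGm : AEStronglyMeasurable G ((stdGaussian E).prod (stdGaussian E)) :=
    aestronglyMeasurable_of_tendsto_ae _ hFm hlim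
  have hFb : ∀ N, ∀ᵐ p ∂(stdGaussian E).prod (stdGaussian E),
      ‖F N p‖ ≤ (K * (Real.pi / 2)) ^ 2 * (‖p.1‖ + ‖p.2‖) ^ 2 := by
    refine fun N => ae_of_all _ fun p => ?_
    have h1 := lipschitz_rotation_bound hf (Real.pi / 2 / (N + 1)) p
    have hN : (0 : ℝ) < N + 1 := by positivity
    rw [abs_of_pos (by positivity : (0 : ℝ) < Real.pi / 2 / (N + 1))] at h1
    simp only [hF, norm_pow, norm_mul, Real.norm_eq_abs, abs_of_pos hN]
    rw [← mul_pow]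
    refine pow_le_pow_left₀ (by positivity) ?_ 2
    calc _ ≤ ((N : ℝ) + 1) * (K * (Real.pi / 2 / (N + 1) * (‖p.1‖ + ‖p.2‖))) := by gcongr
      _ = _ := by field_simp
  have hlimI := tendsto_integral_of_dominated_convergence _ hFm
    (integrable_norm_add_sq.const_mul _) hFb hlim
  have hstep : ∀ N : ℕ, ∫ p : E × E, (f p.2 - f p.1) ^ 2 ∂(stdGaussian E).prod (stdGaussian E) ≤
      ∫ p, F N p ∂(stdGaussian E).prod (stdGaussian E) := by
    intro N
    set h : ℝ := Real.pi / 2 / (N + 1) with hh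
    have hN : (0 : ℝ) < N + 1 := by positivity
    set Φ : ℕ → E × E → ℝ := fun j p => f (Real.cos (j * h) • p.1 + Real.sin (j * h) • p.2)
      with hΦ
    have hmem : ∀ j, MemLp (Φ j) 2 ((stdGaussian E).prod (stdGaussian E)) := by
      intro j
      have h1 := (memLp_two_of_lipschitz hf).comp_fst (stdGaussian E)
      rw [← IsGaussian.map_rotation_eq_self (μ := stdGaussian E) (by simp) (j * h)] at h1
      have h2 := h1.comp_of_map (ContinuousLinearMap.continuous _).aemeasurable
      exact h2
    have hI_sq : ∀ j, Integrable (fun p => (Φ (j + 1) p - Φ j p) ^ 2)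
        ((stdGaussian E).prod (stdGaussian E)) :=
      fun j => ((hmem (j + 1)).sub (hmem j)).integrable_sq
    have hpt : ∀ p : E × E, (f p.2 - f p.1) ^ 2 ≤
        ((N : ℝ) + 1) * ∑ j ∈ Finset.range (N + 1), (Φ (j + 1) p - Φ j p) ^ 2 := by
      intro p
      have h1 := sq_sum_le_card_mul_sum_sq (s := Finset.range (N + 1))
        (f := fun j => Φ (j + 1) p - Φ j p)
      rw [Finset.sum_range_sub (fun j => Φ j p), Finset.card_range] at h1
      have h2 : Φ (N + 1) p = f p.2 := by
        have : ((N + 1 : ℕ) : ℝ) * h = Real.pi / 2 := by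
          rw [hh]; push_cast; field_simp
        simp only [hΦ, this]
        simp
      have h3 : Φ 0 p = f p.1 := by simp [hΦ]
      rw [h2, h3] at h1
      exact_mod_cast h1
    calc ∫ p : E × E, (f p.2 - f p.1) ^ 2 ∂(stdGaussian E).prod (stdGaussian E)
        ≤ ∫ p, ((N : ℝ) + 1) * ∑ j ∈ Finset.range (N + 1), (Φ (j + 1) p - Φ j p) ^ 2
            ∂(stdGaussian E).prod (stdGaussian E) := by
          refine integral_mono_of_nonneg (ae_of_all _ fun p => sq_nonneg _) ?_
            (ae_of_all _ hpt)
          exact (integrable_finsetSum _ fun j _ => hI_sq j).const_mul _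
      _ = ((N : ℝ) + 1) * ∑ j ∈ Finset.range (N + 1),
            ∫ p, (Φ (j + 1) p - Φ j p) ^ 2 ∂(stdGaussian E).prod (stdGaussian E) := by
          rw [integral_const_mul, integral_finsetSum _ fun j _ => hI_sq j]
      _ = ((N : ℝ) + 1) * ∑ j ∈ Finset.range (N + 1),
            ∫ p : E × E, (f (Real.cos h • p.1 + Real.sin h • p.2) - f p.1) ^ 2
        ∂(stdGaussian E).prod (stdGaussian E) := by
          congr 1
          refine Finset.sum_congr rfl fun j _ => ?_
          rw [← integral_sq_rotation_step hfc (j * h) h]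
          simp only [hΦ]
          push_cast
          simp only [add_mul, one_mul]
      _ = ∫ p, F N p ∂(stdGaussian E).prod (stdGaussian E) := by
          simp only [hF, mul_pow, ← hh]
          rw [integral_const_mul, Finset.sum_const, Finset.card_range, nsmul_eq_mul]
          push_cast; ring
  have hle := ge_of_tendsto' hlimI hstep
  refine hle.trans ?_
  have hGb : ∀ p, G p ≤ (Real.pi / 2) ^ 2 * K ^ 2 * ‖p.2‖ ^ 2 := by
    intro p
    have h1 : |fderiv ℝ f p.1 p.2| ≤ K * ‖p.2‖ :=
      (ContinuousLinearMap.le_opNorm _ _).trans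
        (mul_le_mul_of_nonneg_right (norm_fderiv_le_of_lipschitz ℝ hf) (norm_nonneg _))
    have h2 := pow_le_pow_left₀ (abs_nonneg _) h1 2
    rw [sq_abs, mul_pow] at h2
    simp only [hG, mul_pow]
    nlinarith [sq_nonneg (Real.pi / 2)]
  have hGi : Integrable G ((stdGaussian E).prod (stdGaussian E)) := by
    refine (((IsGaussian.memLp_two_id (μ := stdGaussian E)).comp_snd
      (stdGaussian E)).norm.integrable_sq.const_mul
      ((Real.pi / 2) ^ 2 * K ^ 2)).mono' hGm (ae_of_all _ fun p => ?_)
    rw [Real.norm_eq_abs, abs_of_nonneg (sq_nonneg _)]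
    exact hGb p
  rw [integral_prod _ hGi]
  have hx : ∀ x, ∫ y, G (x, y) ∂stdGaussian E ≤ (Real.pi / 2) ^ 2 * K ^ 2 := by
    intro x
    simp only [hG, mul_pow]
    rw [integral_const_mul, integral_sq_dual]
    gcongr
    exact norm_fderiv_le_of_lipschitz ℝ hf
  calc _ ≤ ∫ _ : E, (Real.pi / 2) ^ 2 * K ^ 2 ∂stdGaussian E :=
        integral_mono hGi.integral_prod_left (integrable_const _) hx
    _ = _ := by simp

/-- Gaussian Poincaré inequality for Lipschitz functions. -/
theorem variance_le_of_lipschitz (hf : LipschitzWith K f) : Var[f; stdGaussian E] ≤ 2 * K ^ 2 := by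
  have h2 := memLp_two_of_lipschitz hf
  have h1 : Integrable f (stdGaussian E) := h2.integrable (by norm_num)
  have hsq := h2.integrable_sq
  have key : ∫ p : E × E, (f p.2 - f p.1) ^ 2 ∂(stdGaussian E).prod (stdGaussian E) =
      2 * Var[f; stdGaussian E] := by
    have e : ∀ p : E × E, (f p.2 - f p.1) ^ 2 = f p.2 ^ 2 + f p.1 ^ 2 - 2 * (f p.1 * f p.2) := by
      intro p; ring
    simp_rw [e]
    rw [integral_sub, integral_add, integral_const_mul, integral_prod_mul,
      integral_fun_fst (fun x => f x ^ 2), integral_fun_snd (fun x => f x ^ 2),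
      variance_eq_sub h2]
    · simp; ring
    · exact hsq.comp_snd (stdGaussian E)
    · exact hsq.comp_fst (stdGaussian E)
    · exact (hsq.comp_snd (stdGaussian E)).add (hsq.comp_fst (stdGaussian E))
    · exact (h1.mul_prod h1).const_mul 2
  have h3 := integral_sq_sub_le_of_lipschitz hf
  rw [key] at h3
  have hpi : (Real.pi / 2) ^ 2 ≤ 4 := by
    nlinarith [Real.pi_le_four, Real.pi_pos]
  nlinarith [sq_nonneg (K : ℝ)]

end Poincare

theorem pi_map_curry {ι κ α : Type*} [Fintype ι] [Fintype κ] [MeasurableSpace α] (μ : Measure α)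
    [IsProbabilityMeasure μ] :
    (Measure.pi fun _ : ι × κ => μ).map (fun x i j => x (i, j)) =
      Measure.pi fun _ : ι => Measure.pi fun _ : κ => μ := by
  have h := Measure.infinitePi_map_curry (fun (_ : ι) (_ : κ) => μ)
  simp_rw [Measure.infinitePi_eq_pi] at h
  exact h

instance : IsProbabilityMeasure stdCGaussian :=
  Measure.isProbabilityMeasure_map (by fun_prop)

instance (n m : ℕ) : IsProbabilityMeasure (gaussMatrix n m) :=
  inferInstanceAs (IsProbabilityMeasure (Measure.pi _))

theorem gaussianReal_half_eq_map :
    gaussianReal 0 (1 / 2) = (gaussianReal 0 1).map fun t => (√2)⁻¹ * t := by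
  rw [gaussianReal_map_const_mul]
  congr 1
  · simp
  · ext
    simp

theorem stdCGaussian_eq_map :
    stdCGaussian = (Measure.pi fun _ : Fin 2 => gaussianReal 0 1).map
      fun y => (((√2)⁻¹ * y 0 : ℝ) : ℂ) + ((√2)⁻¹ * y 1 : ℝ) * Complex.I := by
  rw [stdCGaussian, gaussianReal_half_eq_map, Measure.map_prod_map _ _ (by fun_prop)
    (by fun_prop), ← (measurePreserving_finTwoArrow (gaussianReal 0 1)).map_eq,
    Measure.map_map (by fun_prop) (MeasurableEquiv.measurable _),
    Measure.map_map (by fun_prop) (by fun_prop)]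
  rfl

/-- Assemble a complex matrix from its (rescaled) real and imaginary parts. -/
def ofRealParts (n m : ℕ) (x : Fin n × Fin m × Fin 2 → ℝ) : Matrix (Fin n) (Fin m) ℂ :=
  fun i j => (((√2)⁻¹ * x (i, j, 0) : ℝ) : ℂ) + ((√2)⁻¹ * x (i, j, 1) : ℝ) * Complex.I

theorem gaussMatrix_eq_map (n m : ℕ) :
    gaussMatrix n m = (Measure.pi fun _ => gaussianReal 0 1).map (ofRealParts n m) := by
  have h2 : (Measure.pi fun _ : Fin m => stdCGaussian) =
      (Measure.pi fun _ : Fin m × Fin 2 => gaussianReal 0 1).map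
        (fun x j => (((√2)⁻¹ * x (j, 0) : ℝ) : ℂ) + ((√2)⁻¹ * x (j, 1) : ℝ) * Complex.I) := by
    have : SigmaFinite ((Measure.pi fun _ : Fin 2 => gaussianReal 0 1).map
      fun y => (((√2)⁻¹ * y 0 : ℝ) : ℂ) + ((√2)⁻¹ * y 1 : ℝ) * Complex.I) := by
      rw [← stdCGaussian_eq_map]; infer_instance
    rw [stdCGaussian_eq_map, ← Measure.pi_map_pi (fun _ => by fun_prop), ← pi_map_curry,
      Measure.map_map (by fun_prop) (by fun_prop)]
    rfl
  have : SigmaFinite ((Measure.pi fun _ : Fin m × Fin 2 => gaussianReal 0 1).map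
        (fun x (j : Fin m) =>
          (((√2)⁻¹ * x (j, 0) : ℝ) : ℂ) + ((√2)⁻¹ * x (j, 1) : ℝ) * Complex.I)) := by
    rw [← h2]; infer_instance
  rw [gaussMatrix, h2, ← Measure.pi_map_pi (fun _ => by fun_prop), ← pi_map_curry,
    Measure.map_map (by fun_prop) (by fun_prop)]
  rfl

theorem gaussMatrix_eq_map_stdGaussian (n m : ℕ) :
    gaussMatrix n m = (stdGaussian (EuclideanSpace ℝ (Fin n × Fin m × Fin 2))).map
      fun x => ofRealParts n m x.ofLp := by
  rw [gaussMatrix_eq_map, ← map_pi_eq_stdGaussian, Measure.map_map ?_ (by fun_prop)]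
  · rfl
  · unfold ofRealParts
    refine measurable_pi_lambda _ fun i => measurable_pi_lambda _ fun j => ?_
    fun_prop

theorem sum_norm_sq_ofRealParts_sub {n m : ℕ} (x y : Fin n × Fin m × Fin 2 → ℝ) :
    ∑ i, ∑ j, ‖ofRealParts n m x i j - ofRealParts n m y i j‖ ^ 2 =
      (1 / 2) * ∑ p, (x p - y p) ^ 2 := by
  rw [Fintype.sum_prod_type, Finset.mul_sum]
  refine Finset.sum_congr rfl fun i _ => ?_
  rw [Fintype.sum_prod_type, Finset.mul_sum]
  refine Finset.sum_congr rfl fun j _ => ?_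
  rw [Fin.sum_univ_two, ← Complex.normSq_eq_norm_sq, Complex.normSq_apply]
  simp only [ofRealParts, Complex.sub_re, Complex.add_re, Complex.ofReal_re, Complex.mul_re,
    Complex.I_re, Complex.ofReal_im, Complex.I_im, Complex.sub_im, Complex.add_im, Complex.mul_im]
  have : (√2)⁻¹ * (√2)⁻¹ = (1 / 2 : ℝ) := by
    rw [← mul_inv, Real.mul_self_sqrt (by norm_num)]; norm_num
  linear_combination ((x (i, j, 0) - y (i, j, 0)) ^ 2 + (x (i, j, 1) - y (i, j, 1)) ^ 2) * this

section

variable {n m : ℕ} {f : Matrix (Fin n) (Fin m) ℂ → ℝ}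

theorem lipschitzWith_comp_ofRealParts
    (hf : ∀ X Y, (f X - f Y) ^ 2 ≤ ∑ i, ∑ j, ‖X i j - Y i j‖ ^ 2) :
    LipschitzWith (NNReal.sqrt (1 / 2)) fun x : EuclideanSpace ℝ (Fin n × Fin m × Fin 2) =>
      f (ofRealParts n m x.ofLp) := by
  refine LipschitzWith.of_dist_le_mul fun x y => ?_
  have h := hf (ofRealParts n m x.ofLp) (ofRealParts n m y.ofLp)
  rw [sum_norm_sq_ofRealParts_sub] at h
  rw [Real.dist_eq, EuclideanSpace.dist_eq, Real.coe_sqrt, ← Real.sqrt_mul (by positivity)]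
  refine Real.abs_le_sqrt (h.trans (le_of_eq ?_))
  simp [Real.dist_eq, sq_abs]

theorem measurable_ofRealParts :
    Measurable fun x : EuclideanSpace ℝ (Fin n × Fin m × Fin 2) => ofRealParts n m x.ofLp := by
  unfold ofRealParts
  refine measurable_pi_lambda _ fun i => measurable_pi_lambda _ fun j => ?_
  fun_prop

theorem memLp_two_gaussMatrix (hm : Measurable f)
    (hf : ∀ X Y, (f X - f Y) ^ 2 ≤ ∑ i, ∑ j, ‖X i j - Y i j‖ ^ 2) :
    MemLp f 2 (gaussMatrix n m) := by
  rw [gaussMatrix_eq_map_stdGaussian, memLp_map_measure_iff hm.aestronglyMeasurable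
    measurable_ofRealParts.aemeasurable]
  exact memLp_two_of_lipschitz (lipschitzWith_comp_ofRealParts hf)

/-- Gaussian Poincaré inequality for functions of a complex Gaussian matrix which are Lipschitz
with respect to the Frobenius norm. -/
theorem variance_gaussMatrix_le (hm : Measurable f)
    (hf : ∀ X Y, (f X - f Y) ^ 2 ≤ ∑ i, ∑ j, ‖X i j - Y i j‖ ^ 2) :
    Var[f; gaussMatrix n m] ≤ 1 := by
  rw [gaussMatrix_eq_map_stdGaussian, variance_map hm.aemeasurable
    measurable_ofRealParts.aemeasurable]
  refine (variance_le_of_lipschitz (lipschitzWith_comp_ofRealParts hf)).trans (le_of_eq ?_)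
  rw [Real.coe_sqrt, Real.sq_sqrt (by positivity)]
  norm_num

end

theorem hasDerivAt_gaussianPDFReal {v : NNReal} (x : ℝ) :
    HasDerivAt (gaussianPDFReal 0 v) (-(x / v) * gaussianPDFReal 0 v x) x := by
  unfold gaussianPDFReal
  have h1 : HasDerivAt (fun x : ℝ => -(x - 0) ^ 2 / (2 * v)) (-(x / v)) x := by
    have h2 := ((((hasDerivAt_id x).sub_const 0).pow 2).neg).div_const (2 * (v : ℝ))
    refine h2.congr_deriv ?_
    simp only [id, Nat.cast_ofNat, Nat.add_one_sub_one, pow_one, mul_one, sub_zero]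
    rw [neg_div, mul_div_mul_left _ _ two_ne_zero]
  have h3 := h1.exp.const_mul (√(2 * Real.pi * v))⁻¹
  refine h3.congr_deriv ?_
  ring

theorem integrable_mul_gaussianPDFReal {v : NNReal} (hv : v ≠ 0) :
    Integrable (fun x => x * gaussianPDFReal 0 v x) := by
  have h : Integrable id (gaussianReal 0 v) := (memLp_id_gaussianReal 1).integrable le_rfl
  rw [gaussianReal_of_var_ne_zero _ hv, integrable_withDensity_iff_integrable_smul'
    (measurable_gaussianPDF _ _) (ae_of_all _ fun x => gaussianPDF_lt_top)] at h
  refine h.congr (ae_of_all _ fun x => ?_)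
  simp [toReal_gaussianPDF, mul_comm]

/-- Gaussian integration by parts on the real line. -/
theorem integral_id_mul_gaussianReal {v : NNReal} (hv : v ≠ 0) {g g' : ℝ → ℂ} {C : ℝ}
    (hg : ∀ x, HasDerivAt g (g' x) x) (hb : ∀ x, ‖g x‖ ≤ C) (hb' : ∀ x, ‖g' x‖ ≤ C) :
    ∫ x, (x : ℂ) * g x ∂gaussianReal 0 v = v * ∫ x, g' x ∂gaussianReal 0 v := by
  have hgm : AEStronglyMeasurable g volume :=
    (continuous_iff_continuousAt.2 fun x => (hg x).continuousAt).aestronglyMeasurable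
  have hgm' : AEStronglyMeasurable g' volume := by
    have : g' = deriv g := funext fun x => (hg x).deriv.symm
    rw [this]; exact aestronglyMeasurable_deriv _ _
  have hd : ∀ x, HasDerivAt (fun x => (gaussianPDFReal 0 v x : ℂ))
      ((-(x / v) * gaussianPDFReal 0 v x : ℝ) : ℂ) x := fun x =>
    (hasDerivAt_gaussianPDFReal x).ofReal_comp
  have hi0 : Integrable (fun x => (gaussianPDFReal 0 v x : ℂ)) :=
    (integrable_gaussianPDFReal 0 v).ofReal
  have hi1 : Integrable (fun x => ((-(x / v) * gaussianPDFReal 0 v x : ℝ) : ℂ)) := by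
    have : Integrable (fun x => -(x / v) * gaussianPDFReal 0 v x) := by
      refine ((integrable_mul_gaussianPDFReal hv).const_mul (-(v : ℝ)⁻¹)).congr
        (ae_of_all _ fun x => ?_)
      simp only; ring
    exact this.ofReal
  have h := integral_mul_deriv_eq_deriv_mul_of_integrable (fun x _ => hg x) (fun x _ => hd x)
    (hi1.bdd_mul hgm (ae_of_all _ hb)) (hi0.bdd_mul hgm' (ae_of_all _ hb'))
    (hi0.bdd_mul hgm (ae_of_all _ hb))
  rw [integral_gaussianReal_eq_integral_smul hv, integral_gaussianReal_eq_integral_smul hv]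
  have hv' : (v : ℂ) ≠ 0 := by exact_mod_cast hv
  have e1 : ∫ x, gaussianPDFReal 0 v x • ((x : ℂ) * g x) =
      -(v : ℂ) * ∫ x, g x * ((-(x / v) * gaussianPDFReal 0 v x : ℝ) : ℂ) := by
    rw [← integral_const_mul]
    refine integral_congr_ae (ae_of_all _ fun x => ?_)
    simp only [Complex.real_smul]
    push_cast
    field_simp
  have e2 : ∫ x, gaussianPDFReal 0 v x • g' x = ∫ x, g' x * (gaussianPDFReal 0 v x : ℂ) := by
    refine integral_congr_ae (ae_of_all _ fun x => ?_)
    simp only [Complex.real_smul]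
    ring
  rw [e1, e2, h]
  ring

theorem integrable_ofReal_gaussianReal (v : NNReal) :
    Integrable (fun x : ℝ => (x : ℂ)) (gaussianReal 0 v) :=
  ((memLp_id_gaussianReal (μ := 0) (v := v) 1).integrable le_rfl).ofReal

theorem integrable_conj_stdCGaussian :
    Integrable (fun z : ℂ => starRingEnd ℂ z) stdCGaussian := by
  rw [stdCGaussian, integrable_map_measure (by fun_prop) (by fun_prop)]
  have h1 := (integrable_ofReal_gaussianReal (1 / 2)).comp_fst (gaussianReal 0 (1 / 2))
  have h2 := (integrable_ofReal_gaussianReal (1 / 2)).comp_snd (gaussianReal 0 (1 / 2))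
  refine (h1.sub (h2.mul_const Complex.I)).congr (ae_of_all _ fun p => ?_)
  simp [sub_eq_add_neg]

/-- Complex Gaussian integration by parts, with `a` and `b` the Wirtinger derivatives of `F`. -/
theorem integral_conj_mul_stdCGaussian {F a b : ℂ → ℂ} {C : ℝ} (hF : Measurable F)
    (ha : Measurable a) (hb : Measurable b)
    (hd : ∀ z c, HasDerivAt (fun t : ℝ => F (z + t * c)) (c * a z + starRingEnd ℂ c * b z) 0)
    (hFC : ∀ z, ‖F z‖ ≤ C) (haC : ∀ z, ‖a z‖ ≤ C) (hbC : ∀ z, ‖b z‖ ≤ C) :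
    ∫ z, starRingEnd ℂ z * F z ∂stdCGaussian = ∫ z, a z ∂stdCGaussian := by
  have hmeas : Measurable fun p : ℝ × ℝ => (p.1 : ℂ) + p.2 * Complex.I := by fun_prop
  have hshift : ∀ {g : ℝ → ℂ} {d : ℂ} {x : ℝ}, HasDerivAt (fun t : ℝ => g (x + t)) d 0 →
      HasDerivAt g d x := by
    intro g d x h
    have h2 : HasDerivAt (fun t : ℝ => g (x + t)) d (x - x) := by simpa using h
    have := h2.comp_sub_const x x
    simpa using this
  have hdx : ∀ x y : ℝ, HasDerivAt (fun x : ℝ => F (x + y * Complex.I))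
      (a (x + y * Complex.I) + b (x + y * Complex.I)) x := by
    intro x y
    refine hshift ?_
    convert hd (x + y * Complex.I) 1 using 1
    · ext t; congr 1; push_cast; ring
    · simp
  have hdy : ∀ x y : ℝ, HasDerivAt (fun y : ℝ => F (x + y * Complex.I))
      (Complex.I * a (x + y * Complex.I) - Complex.I * b (x + y * Complex.I)) y := by
    intro x y
    refine hshift ?_
    convert hd (x + y * Complex.I) Complex.I using 1
    · ext t; congr 1; push_cast; ring
    · simp [sub_eq_add_neg]
  set g := gaussianReal 0 (1 / 2) with hg
  have hv : (1 / 2 : NNReal) ≠ 0 := by simp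
  have hC : 0 ≤ C := (norm_nonneg _).trans (hFC 0)
  have hi : ∀ {G : ℂ → ℂ}, Measurable G → (∀ z, ‖G z‖ ≤ C) →
      Integrable (fun p : ℝ × ℝ => G ((p.1 : ℂ) + p.2 * Complex.I)) (g.prod g) := by
    intro G hG hGC
    exact Integrable.of_bound (hG.comp hmeas).aestronglyMeasurable C (ae_of_all _ fun p => hGC _)
  have hix : Integrable (fun p : ℝ × ℝ => (p.1 : ℂ) * F ((p.1 : ℂ) + p.2 * Complex.I))
      (g.prod g) :=
    ((integrable_ofReal_gaussianReal (1 / 2)).comp_fst g).mul_bdd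
      (hF.comp hmeas).aestronglyMeasurable (ae_of_all _ fun p => hFC _)
  have hiy : Integrable (fun p : ℝ × ℝ => (p.2 : ℂ) * F ((p.1 : ℂ) + p.2 * Complex.I))
      (g.prod g) :=
    ((integrable_ofReal_gaussianReal (1 / 2)).comp_snd g).mul_bdd
      (hF.comp hmeas).aestronglyMeasurable (ae_of_all _ fun p => hFC _)
  have ex : ∫ p : ℝ × ℝ, (p.1 : ℂ) * F ((p.1 : ℂ) + p.2 * Complex.I) ∂(g.prod g) =
      (1 / 2) * (∫ p : ℝ × ℝ, a ((p.1 : ℂ) + p.2 * Complex.I) ∂(g.prod g)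
        + ∫ p : ℝ × ℝ, b ((p.1 : ℂ) + p.2 * Complex.I) ∂(g.prod g)) := by
    have hab : Integrable (fun p : ℝ × ℝ => (1 / 2 : ℂ) * (a ((p.1 : ℂ) + p.2 * Complex.I)
        + b ((p.1 : ℂ) + p.2 * Complex.I))) (g.prod g) :=
      ((hi ha haC).add (hi hb hbC)).const_mul _
    rw [← integral_add (hi ha haC) (hi hb hbC), ← integral_const_mul,
      integral_prod_symm _ hix, integral_prod_symm _ hab]
    refine integral_congr_ae (ae_of_all _ fun y => ?_)
    simp only
    rw [integral_id_mul_gaussianReal (C := 2 * C) hv (fun x => hdx x y), integral_const_mul]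
    · simp [hg]
    · intro x; exact (hFC _).trans (by linarith)
    · intro x
      exact (norm_add_le _ _).trans (by
        linarith [haC (x + y * Complex.I), hbC (x + y * Complex.I)])
  have ey : ∫ p : ℝ × ℝ, (p.2 : ℂ) * F ((p.1 : ℂ) + p.2 * Complex.I) ∂(g.prod g) =
      (1 / 2 * Complex.I) * (∫ p : ℝ × ℝ, a ((p.1 : ℂ) + p.2 * Complex.I) ∂(g.prod g)
        - ∫ p : ℝ × ℝ, b ((p.1 : ℂ) + p.2 * Complex.I) ∂(g.prod g)) := by
    have hab : Integrable (fun p : ℝ × ℝ => (1 / 2 * Complex.I : ℂ) *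
        (a ((p.1 : ℂ) + p.2 * Complex.I) - b ((p.1 : ℂ) + p.2 * Complex.I))) (g.prod g) :=
      ((hi ha haC).sub (hi hb hbC)).const_mul _
    rw [← integral_sub (hi ha haC) (hi hb hbC), ← integral_const_mul,
      integral_prod _ hiy, integral_prod _ hab]
    refine integral_congr_ae (ae_of_all _ fun x => ?_)
    simp only
    rw [integral_id_mul_gaussianReal (C := 2 * C) hv (fun y => hdy x y), integral_const_mul]
    · simp_rw [← mul_sub]
      rw [integral_const_mul]
      simp [mul_assoc, hg]
    · intro y; exact (hFC _).trans (by linarith)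
    · intro y
      refine (norm_sub_le _ _).trans ?_
      simp only [norm_mul, Complex.norm_I, one_mul]
      linarith [haC (x + y * Complex.I), hbC (x + y * Complex.I)]
  rw [stdCGaussian, integral_map (by fun_prop) (by fun_prop), integral_map (by fun_prop)
    (by fun_prop)]
  have e : ∀ p : ℝ × ℝ, starRingEnd ℂ ((p.1 : ℂ) + p.2 * Complex.I) *
      F ((p.1 : ℂ) + p.2 * Complex.I) = (p.1 : ℂ) * F ((p.1 : ℂ) + p.2 * Complex.I)
        - Complex.I * ((p.2 : ℂ) * F ((p.1 : ℂ) + p.2 * Complex.I)) := by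
    intro p; simp; ring
  simp_rw [e]
  rw [integral_sub hix (hiy.const_mul _), integral_const_mul, ex, ey]
  linear_combination (-(1 / 2 : ℂ) * (∫ p : ℝ × ℝ, a ((p.1 : ℂ) + p.2 * Complex.I) ∂(g.prod g)
        - ∫ p : ℝ × ℝ, b ((p.1 : ℂ) + p.2 * Complex.I) ∂(g.prod g))) * Complex.I_sq

theorem measurable_update_prod {ι : Type*} [DecidableEq ι] {α : ι → Type*}
    [∀ i, MeasurableSpace (α i)] (i : ι) :
    Measurable fun p : (∀ i, α i) × α i => Function.update p.1 i p.2 := by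
  refine measurable_pi_lambda _ fun j => ?_
  by_cases h : j = i
  · subst h; simpa using measurable_snd
  · simp only [Function.update_of_ne h]
    exact (measurable_pi_apply j).comp measurable_fst

theorem pi_map_update {ι : Type*} [Fintype ι] [DecidableEq ι] {α : ι → Type*}
    [∀ i, MeasurableSpace (α i)] (μ : ∀ i, Measure (α i)) [∀ i, IsProbabilityMeasure (μ i)]
    (i : ι) :
    ((Measure.pi μ).prod (μ i)).map (fun p => Function.update p.1 i p.2) = Measure.pi μ := by
  refine (Measure.pi_eq fun s hs => ?_).symm
  rw [Measure.map_apply (measurable_update_prod i) (MeasurableSet.univ_pi hs)]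
  have : (fun p : (∀ i, α i) × α i => Function.update p.1 i p.2) ⁻¹' Set.univ.pi s =
      (Set.univ.pi (Function.update s i Set.univ)) ×ˢ s i := by
    ext p
    simp only [Set.mem_preimage, Set.mem_pi, Set.mem_univ, true_imp_iff, Set.mem_prod]
    constructor
    · intro h
      refine ⟨fun j => ?_, by simpa using h i⟩
      by_cases hj : j = i
      · subst hj; simp
      · simpa [hj] using h j
    · rintro ⟨h1, h2⟩ j
      by_cases hj : j = i
      · subst hj; simpa using h2
      · simpa [hj] using h1 j
  rw [this, Measure.prod_prod, Measure.pi_pi, ← Finset.mul_prod_erase _ _ (Finset.mem_univ i),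
    ← Finset.mul_prod_erase Finset.univ (fun j => μ j (s j)) (Finset.mem_univ i)]
  simp only [Function.update_self, measure_univ, one_mul]
  rw [mul_comm]
  congr 1
  refine Finset.prod_congr rfl fun j hj => ?_
  rw [Function.update_of_ne (Finset.ne_of_mem_erase hj)]

theorem integral_pi_update {ι : Type*} [Fintype ι] [DecidableEq ι] {α : ι → Type*}
    [∀ i, MeasurableSpace (α i)] (μ : ∀ i, Measure (α i)) [∀ i, IsProbabilityMeasure (μ i)]
    (i : ι) {f : (∀ i, α i) → ℂ} (hf : Integrable f (Measure.pi μ)) :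
    ∫ x, f x ∂Measure.pi μ = ∫ x, ∫ y, f (Function.update x i y) ∂μ i ∂Measure.pi μ := by
  have hf' := hf
  rw [← pi_map_update μ i] at hf'
  conv_lhs => rw [← pi_map_update μ i]
  rw [integral_map (measurable_update_prod i).aemeasurable hf'.aestronglyMeasurable]
  exact integral_prod _ (hf'.comp_measurable (measurable_update_prod i))

theorem integrable_conj_entry {n m : ℕ} (i : Fin n) (j : Fin m) :
    Integrable (fun G : Matrix (Fin n) (Fin m) ℂ => starRingEnd ℂ (G i j)) (gaussMatrix n m) :=
  (measurePreserving_eval (fun _ : Fin n => Measure.pi fun _ : Fin m => stdCGaussian)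
    i).integrable_comp_of_integrable
    ((measurePreserving_eval (fun _ : Fin m => stdCGaussian) j).integrable_comp_of_integrable
      integrable_conj_stdCGaussian)

/-- Gaussian integration by parts for complex Gaussian matrices. -/
theorem integral_conj_entry_mul {n m : ℕ} (i : Fin n) (j : Fin m)
    {F A B : Matrix (Fin n) (Fin m) ℂ → ℂ} {C : ℝ} (hF : Measurable F)
    (hA : Measurable A) (hB : Measurable B)
    (hd : ∀ G c, HasDerivAt (fun t : ℝ => F (G + Matrix.single i j ((t : ℂ) * c)))
      (c * A G + starRingEnd ℂ c * B G) 0)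
    (hFC : ∀ G, ‖F G‖ ≤ C) (hAC : ∀ G, ‖A G‖ ≤ C) (hBC : ∀ G, ‖B G‖ ≤ C) :
    ∫ G, starRingEnd ℂ (G i j) * F G ∂gaussMatrix n m = ∫ G, A G ∂gaussMatrix n m := by
  have hfi : ∀ {μ : Measure (Matrix (Fin n) (Fin m) ℂ)} [IsProbabilityMeasure μ]
      {G : Matrix (Fin n) (Fin m) ℂ → ℂ}, Measurable G → (∀ X, ‖G X‖ ≤ C) → Integrable G μ :=
    fun hG hGC => Integrable.of_bound hG.aestronglyMeasurable C (ae_of_all _ hGC)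
  have hrow : Integrable (fun r : Fin m → ℂ => starRingEnd ℂ (r j))
      (Measure.pi fun _ : Fin m => stdCGaussian) :=
    (measurePreserving_eval (fun _ : Fin m => stdCGaussian) j).integrable_comp_of_integrable
      integrable_conj_stdCGaussian
  have hent := integrable_conj_entry i j
  have hupd : ∀ G : Matrix (Fin n) (Fin m) ℂ,
      Measurable fun r : Fin m → ℂ => G.updateRow i r :=
    fun G => measurable_update (X := fun _ : Fin n => Fin m → ℂ) G (a := i)
  have hupd2 : ∀ (G : Matrix (Fin n) (Fin m) ℂ) (r : Fin m → ℂ), Measurable fun z : ℂ =>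
      G.updateRow i (Function.update r j z) :=
    fun G r => (hupd G).comp (measurable_update r)
  have hsplit : ∀ {f : Matrix (Fin n) (Fin m) ℂ → ℂ}, Integrable f (gaussMatrix n m) →
      (∀ G : Matrix (Fin n) (Fin m) ℂ, Integrable
        (fun r : Fin m → ℂ => f (G.updateRow i r)) (Measure.pi fun _ => stdCGaussian)) →
      ∫ G, f G ∂gaussMatrix n m = ∫ G : Matrix (Fin n) (Fin m) ℂ, ∫ r : Fin m → ℂ, ∫ z,
        f (G.updateRow i (Function.update r j z)) ∂stdCGaussian
          ∂(Measure.pi fun _ => stdCGaussian) ∂gaussMatrix n m := by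
    intro f hf hf2
    refine (integral_pi_update (fun _ : Fin n => Measure.pi fun _ : Fin m => stdCGaussian)
      i hf).trans ?_
    refine integral_congr_ae (ae_of_all _ fun G => ?_)
    exact integral_pi_update (fun _ : Fin m => stdCGaussian) j (hf2 G)
  rw [hsplit, hsplit (f := A)]
  · refine integral_congr_ae (ae_of_all _ fun G => integral_congr_ae (ae_of_all _ fun r => ?_))
    simp only [Matrix.updateRow_self, Function.update_self]
    refine integral_conj_mul_stdCGaussian (C := C) (hF.comp (hupd2 G r)) (hA.comp (hupd2 G r))
      (hB.comp (hupd2 G r)) (fun z c => ?_) (fun z => hFC _) (fun z => hAC _) (fun z => hBC _)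
    have e : ∀ t : ℝ, G.updateRow i (Function.update r j (z + t * c)) =
        G.updateRow i (Function.update r j z) + Matrix.single i j ((t : ℂ) * c) := by
      intro t
      ext k l
      by_cases hk : k = i
      · subst hk
        by_cases hl : l = j
        · subst hl; simp
        · simp [hl, Ne.symm hl]
      · simp [hk, Ne.symm hk, Matrix.updateRow_ne]
    simp only [Function.comp_apply, e]
    exact hd _ c
  · exact hfi hA hAC
  · exact fun G => Integrable.of_bound (hA.comp (hupd G)).aestronglyMeasurable C
      (ae_of_all _ fun r => hAC _)
  · exact hent.mul_bdd hF.aestronglyMeasurable (ae_of_all _ hFC)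
  · intro G
    simp only [Matrix.updateRow_self]
    exact hrow.mul_bdd (hF.comp (hupd G)).aestronglyMeasurable (ae_of_all _ fun r => hFC _)

section EntrywiseDerivative

variable {a b c : Type*}

/-- Entrywise derivative of a matrix-valued function of a real variable. -/
def HasMatrixDerivAt (X : ℝ → Matrix a b ℂ) (X' : Matrix a b ℂ) (t : ℝ) : Prop :=
  ∀ i j, HasDerivAt (fun s => X s i j) (X' i j) t

theorem HasMatrixDerivAt.mul [Fintype b] {X : ℝ → Matrix a b ℂ} {Y : ℝ → Matrix b c ℂ}
    {X' : Matrix a b ℂ}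
    {Y' : Matrix b c ℂ} {t : ℝ} (hX : HasMatrixDerivAt X X' t) (hY : HasMatrixDerivAt Y Y' t) :
    HasMatrixDerivAt (fun s => X s * Y s) (X' * Y t + X t * Y') t := by
  intro i j
  simp only [Matrix.mul_apply, Matrix.add_apply, ← Finset.sum_add_distrib]
  exact HasDerivAt.fun_sum fun k _ => (hX i k).mul (hY k j)

theorem HasMatrixDerivAt.conjTranspose {X : ℝ → Matrix a b ℂ} {X' : Matrix a b ℂ} {t : ℝ}
    (hX : HasMatrixDerivAt X X' t) :
    HasMatrixDerivAt (fun s => (X s).conjTranspose) X'.conjTranspose t := by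
  intro i j
  exact (hX j i).star

theorem HasMatrixDerivAt.trace [Fintype a] {X : ℝ → Matrix a a ℂ} {X' : Matrix a a ℂ} {t : ℝ}
    (hX : HasMatrixDerivAt X X' t) : HasDerivAt (fun s => (X s).trace) X'.trace t :=
  HasDerivAt.fun_sum fun i _ => hX i i

theorem HasMatrixDerivAt.const_add {X : ℝ → Matrix a b ℂ} {X' : Matrix a b ℂ} {t : ℝ}
    (hX : HasMatrixDerivAt X X' t) (A : Matrix a b ℂ) :
    HasMatrixDerivAt (fun s => A + X s) X' t :=
  fun i j => (hX i j).const_add (A i j)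

theorem hasMatrixDerivAt_add_single [DecidableEq a] [DecidableEq b] (G : Matrix a b ℂ) (i : a)
    (j : b) (z : ℂ) :
    HasMatrixDerivAt (fun t : ℝ => G + Matrix.single i j ((t : ℂ) * z))
      (Matrix.single i j z) 0 := by
  intro k l
  simp only [Matrix.add_apply, Matrix.single_apply]
  split_ifs
  · have h := ((Complex.ofRealCLM.hasDerivAt (x := 0)).mul_const z).const_add (G k l)
    simpa using h
  · exact hasDerivAt_const _ _

theorem HasMatrixDerivAt.pow [Fintype a] [DecidableEq a] {X : ℝ → Matrix a a ℂ}
    {X' : Matrix a a ℂ} {t : ℝ}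
    (hX : HasMatrixDerivAt X X' t) (k : ℕ) :
    HasMatrixDerivAt (fun s => X s ^ (k + 1))
      (∑ p ∈ Finset.range (k + 1), X t ^ p * X' * X t ^ (k - p)) t := by
  induction k with
  | zero => simpa using hX
  | succ k ih =>
    have h := ih.mul hX
    simp_rw [pow_succ _ (k + 1)]
    convert h using 1
    rw [Finset.sum_range_succ, Finset.sum_mul]
    simp only [tsub_self, pow_zero, mul_one, add_left_inj]
    refine Finset.sum_congr rfl fun p hp => ?_
    rw [Nat.sub_add_comm (by simpa [Nat.lt_succ_iff] using hp), pow_succ]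
    simp only [Matrix.mul_assoc]

attribute [local instance] Matrix.linftyOpNormedRing Matrix.linftyOpNormedAlgebra

theorem hasMatrixDerivAt_iff [Fintype a] [DecidableEq a] {X : ℝ → Matrix a a ℂ}
    {X' : Matrix a a ℂ} {t : ℝ} :
    HasMatrixDerivAt X X' t ↔ HasDerivAt X X' t := by
  constructor
  · intro h
    have h1 : HasDerivAt (fun s => ∑ i, ∑ j, X s i j • Matrix.single i j (1 : ℂ))
        (∑ i, ∑ j, X' i j • Matrix.single i j (1 : ℂ)) t :=
      HasDerivAt.fun_sum fun i _ => HasDerivAt.fun_sum fun j _ => (h i j).smul_const _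
    simpa [Matrix.smul_single, ← Matrix.matrix_eq_sum_single] using h1
  · intro h i j
    exact ((LinearMap.toContinuousLinearMap
      (Matrix.entryLinearMap ℝ ℂ i j)).hasFDerivAt.comp_hasDerivAt t h)

theorem HasMatrixDerivAt.inv [Fintype a] [DecidableEq a] {X : ℝ → Matrix a a ℂ}
    {X' : Matrix a a ℂ} {t : ℝ}
    (hX : HasMatrixDerivAt X X' t) (hu : IsUnit (X t)) :
    HasMatrixDerivAt (fun s => (X s)⁻¹) (-((X t)⁻¹ * X' * (X t)⁻¹)) t := by
  rw [hasMatrixDerivAt_iff] at hX ⊢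
  obtain ⟨u, hu⟩ := hu
  have h : HasFDerivAt Ring.inverse _ (X t) := hu ▸ hasFDerivAt_ringInverse (𝕜 := ℝ) u
  have h2 := h.comp_hasDerivAt t hX
  simp only [Function.comp_def, ← Matrix.nonsing_inv_eq_ringInverse] at h2
  refine h2.congr_deriv ?_
  rw [← hu, ← Matrix.coe_units_inv]
  simp

end EntrywiseDerivative

theorem mul_single_mul_apply {a b c d : Type*} [Fintype b] [Fintype c] [DecidableEq b]
    [DecidableEq c] (X : Matrix a b ℂ) (Y : Matrix c d ℂ) (i : b) (j : c) (z : ℂ) (k : a) (l : d) :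
    (X * Matrix.single i j z * Y) k l = X k i * z * Y j l := by
  rw [Matrix.mul_apply, Finset.sum_eq_single j]
  · rw [Matrix.mul_single_apply_same]
  · intro x _ hx
    rw [Matrix.mul_single_apply_of_ne _ _ _ _ _ hx, zero_mul]
  · simp

section Resolvent

variable {n m : ℕ}

/-- The resolvent `(1 + G Gᴴ)⁻¹`. -/
def wishartResolvent (G : Matrix (Fin n) (Fin m) ℂ) : Matrix (Fin n) (Fin n) ℂ :=
  (1 + G * G.conjTranspose)⁻¹

theorem isUnit_one_add_mul_conjTranspose (G : Matrix (Fin n) (Fin m) ℂ) :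
    IsUnit (1 + G * G.conjTranspose) := by
  open scoped ComplexOrder in
  exact (Matrix.PosDef.one.add_posSemidef (Matrix.posSemidef_self_mul_conjTranspose G)).isUnit

theorem resolvent_mul (G : Matrix (Fin n) (Fin m) ℂ) :
    wishartResolvent G * (G * G.conjTranspose) = 1 - wishartResolvent G := by
  have h : wishartResolvent G * (1 + G * G.conjTranspose) = 1 :=
    Matrix.nonsing_inv_mul _ ((Matrix.isUnit_iff_isUnit_det _).1
      (isUnit_one_add_mul_conjTranspose G))
  rw [mul_add, mul_one] at h
  exact eq_sub_of_add_eq' h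

theorem resolvent_pow_succ_mul (G : Matrix (Fin n) (Fin m) ℂ) (k : ℕ) :
    wishartResolvent G ^ (k + 1) * (G * G.conjTranspose) =
      wishartResolvent G ^ k - wishartResolvent G ^ (k + 1) := by
  rw [pow_succ, Matrix.mul_assoc, resolvent_mul, mul_sub, mul_one]

theorem resolvent_conjTranspose (G : Matrix (Fin n) (Fin m) ℂ) :
    (wishartResolvent G).conjTranspose = wishartResolvent G := by
  rw [wishartResolvent, Matrix.conjTranspose_nonsing_inv]
  simp

theorem hasMatrixDerivAt_resolvent (G : Matrix (Fin n) (Fin m) ℂ) (i : Fin n) (j : Fin m) (z : ℂ) :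
    HasMatrixDerivAt (fun t : ℝ => wishartResolvent (G + Matrix.single i j ((t : ℂ) * z)))
      (-(wishartResolvent G * (Matrix.single i j z * G.conjTranspose +
        G * Matrix.single j i (starRingEnd ℂ z)) * wishartResolvent G)) 0 := by
  have h0 := hasMatrixDerivAt_add_single G i j z
  have h1 := ((h0.mul h0.conjTranspose).const_add 1).inv (by
    simpa using isUnit_one_add_mul_conjTranspose G)
  simpa [wishartResolvent] using h1

theorem norm_entry_le_one_of_sq {a b : Type*} [Fintype a] [Fintype b] {S : Matrix a a ℂ}
    {X : Matrix a b ℂ} (h : S * S.conjTranspose + X * X.conjTranspose = S) (i : a) :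
    (∀ j, ‖S i j‖ ≤ 1) ∧ ∀ j, ‖X i j‖ ≤ 1 := by
  have h1 : (∑ j, ‖S i j‖ ^ 2 + ∑ j, ‖X i j‖ ^ 2 : ℝ) = (S i i).re := by
    have h2 := congrFun (congrFun h i) i
    rw [← h2]
    simp only [Matrix.add_apply, Matrix.mul_apply, Matrix.conjTranspose_apply, Complex.star_def,
      Complex.mul_conj', Complex.add_re, Complex.re_sum]
    norm_cast
  have h2 : (S i i).re ≤ ‖S i i‖ := Complex.re_le_norm _
  have h3 : ∀ j, ‖S i j‖ ^ 2 ≤ ∑ j, ‖S i j‖ ^ 2 := fun j =>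
    Finset.single_le_sum (f := fun j => ‖S i j‖ ^ 2) (fun _ _ => sq_nonneg _) (Finset.mem_univ j)
  have h4 : ∀ j, ‖X i j‖ ^ 2 ≤ ∑ j, ‖X i j‖ ^ 2 := fun j =>
    Finset.single_le_sum (f := fun j => ‖X i j‖ ^ 2) (fun _ _ => sq_nonneg _) (Finset.mem_univ j)
  have h5 : 0 ≤ ∑ j, ‖X i j‖ ^ 2 := Finset.sum_nonneg fun _ _ => sq_nonneg _
  have h6 : ‖S i i‖ ≤ 1 := by nlinarith [h3 i, norm_nonneg (S i i)]
  constructor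
  · intro j
    exact (sq_le_one_iff₀ (norm_nonneg _)).1 (by linarith [h3 j])
  · intro j
    have h7 : 0 ≤ ∑ j, ‖S i j‖ ^ 2 := Finset.sum_nonneg fun _ _ => sq_nonneg _
    exact (sq_le_one_iff₀ (norm_nonneg _)).1 (by linarith [h4 j])

theorem norm_resolvent_le (G : Matrix (Fin n) (Fin m) ℂ) (i : Fin n) :
    (∀ j, ‖wishartResolvent G i j‖ ≤ 1) ∧ ∀ j, ‖(wishartResolvent G * G) i j‖ ≤ 1 := by
  refine norm_entry_le_one_of_sq ?_ i
  rw [Matrix.conjTranspose_mul, resolvent_conjTranspose, Matrix.mul_assoc, ← Matrix.mul_assoc G,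
    ← Matrix.mul_assoc, resolvent_mul, sub_mul, one_mul]
  abel

theorem norm_conjTranspose_mul_resolvent_mul_le (G : Matrix (Fin n) (Fin m) ℂ) (i j : Fin m) :
    ‖(G.conjTranspose * wishartResolvent G * G) i j‖ ≤ 1 := by
  refine (norm_entry_le_one_of_sq (X := (wishartResolvent G * G).conjTranspose) ?_ i).1 j
  simp only [Matrix.conjTranspose_mul, resolvent_conjTranspose, Matrix.conjTranspose_conjTranspose]
  have h : G.conjTranspose * wishartResolvent G * G * (G.conjTranspose * (wishartResolvent G * G)) =
      G.conjTranspose * (wishartResolvent G * (G * G.conjTranspose)) *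
        (wishartResolvent G * G) := by
    simp only [Matrix.mul_assoc]
  rw [h, resolvent_mul]
  simp only [Matrix.mul_sub, Matrix.sub_mul, Matrix.mul_one, Matrix.mul_assoc]
  abel

end Resolvent

section Tame

variable {n m : ℕ}

/-- Bounded measurable functions of a complex matrix. -/
def Tame (f : Matrix (Fin n) (Fin m) ℂ → ℂ) : Prop :=
  Measurable f ∧ ∃ C, ∀ G, ‖f G‖ ≤ C

/-- Matrix-valued functions with bounded measurable entries. -/
def MatrixTame {a b : Type*} (X : Matrix (Fin n) (Fin m) ℂ → Matrix a b ℂ) : Prop :=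
  ∀ i j, Tame fun G => X G i j

theorem tame_const (c : ℂ) : Tame (fun _ : Matrix (Fin n) (Fin m) ℂ => c) :=
  ⟨measurable_const, ‖c‖, fun _ => le_rfl⟩

theorem Tame.mul {f g : Matrix (Fin n) (Fin m) ℂ → ℂ} (hf : Tame f) (hg : Tame g) :
    Tame fun G => f G * g G := by
  obtain ⟨hf, C, hC⟩ := hf
  obtain ⟨hg, D, hD⟩ := hg
  refine ⟨hf.mul hg, C * D, fun G => ?_⟩
  rw [norm_mul]
  exact mul_le_mul (hC G) (hD G) (norm_nonneg _) ((norm_nonneg _).trans (hC G))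

theorem Tame.add {f g : Matrix (Fin n) (Fin m) ℂ → ℂ} (hf : Tame f) (hg : Tame g) :
    Tame fun G => f G + g G := by
  obtain ⟨hf, C, hC⟩ := hf
  obtain ⟨hg, D, hD⟩ := hg
  exact ⟨hf.add hg, C + D, fun G => (norm_add_le _ _).trans (add_le_add (hC G) (hD G))⟩

theorem Tame.neg {f : Matrix (Fin n) (Fin m) ℂ → ℂ} (hf : Tame f) : Tame fun G => -f G := by
  obtain ⟨hf, C, hC⟩ := hf
  exact ⟨hf.neg, C, fun G => by simpa using hC G⟩

theorem Tame.sub {f g : Matrix (Fin n) (Fin m) ℂ → ℂ} (hf : Tame f) (hg : Tame g) :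
    Tame fun G => f G - g G := by
  simpa only [sub_eq_add_neg] using hf.add hg.neg

theorem Tame.conj {f : Matrix (Fin n) (Fin m) ℂ → ℂ} (hf : Tame f) :
    Tame fun G => starRingEnd ℂ (f G) := by
  obtain ⟨hf, C, hC⟩ := hf
  exact ⟨Complex.continuous_conj.measurable.comp hf, C, fun G => by simpa using hC G⟩

theorem Tame.pow {f : Matrix (Fin n) (Fin m) ℂ → ℂ} (hf : Tame f) (k : ℕ) :
    Tame fun G => f G ^ k := by
  obtain ⟨hf, C, hC⟩ := hf
  exact ⟨hf.pow_const k, C ^ k, fun G => by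
    rw [norm_pow]; exact pow_le_pow_left₀ (norm_nonneg _) (hC G) k⟩

theorem Tame.sum {κ : Type*} (s : Finset κ) {f : κ → Matrix (Fin n) (Fin m) ℂ → ℂ}
    (hf : ∀ i ∈ s, Tame (f i)) : Tame fun G => ∑ i ∈ s, f i G := by
  classical
  induction s using Finset.induction_on with
  | empty => simpa using tame_const (n := n) (m := m) 0
  | insert i s hi ih =>
    simp only [Finset.sum_insert hi]
    exact (hf i (by simp)).add (ih fun j hj => hf j (by simp [hj]))

theorem Tame.integrable {f : Matrix (Fin n) (Fin m) ℂ → ℂ} (hf : Tame f) :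
    Integrable f (gaussMatrix n m) := by
  obtain ⟨hf, C, hC⟩ := hf
  exact Integrable.of_bound hf.aestronglyMeasurable C (.of_forall hC)

theorem MatrixTame.mul {a b c : Type*} [Fintype b] {X : Matrix (Fin n) (Fin m) ℂ → Matrix a b ℂ}
    {Y : Matrix (Fin n) (Fin m) ℂ → Matrix b c ℂ} (hX : MatrixTame X) (hY : MatrixTame Y) :
    MatrixTame fun G => X G * Y G := by
  intro i j
  simp only [Matrix.mul_apply]
  exact Tame.sum _ fun k _ => (hX i k).mul (hY k j)

theorem MatrixTame.conjTranspose {a b : Type*} {X : Matrix (Fin n) (Fin m) ℂ → Matrix a b ℂ}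
    (hX : MatrixTame X) : MatrixTame fun G => (X G).conjTranspose :=
  fun i j => (hX j i).conj

theorem MatrixTame.pow {a : Type*} [Fintype a] [DecidableEq a]
    {X : Matrix (Fin n) (Fin m) ℂ → Matrix a a ℂ} (hX : MatrixTame X) (k : ℕ) :
    MatrixTame fun G => X G ^ k := by
  induction k with
  | zero => exact fun i j => tame_const _
  | succ k ih => simpa only [pow_succ] using ih.mul hX

theorem MatrixTame.trace {a : Type*} [Fintype a]
    {X : Matrix (Fin n) (Fin m) ℂ → Matrix a a ℂ} (hX : MatrixTame X) :
    Tame fun G => (X G).trace :=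
  Tame.sum _ fun i _ => hX i i

instance {a b : Type*} [Countable a] [Countable b] : BorelSpace (Matrix a b ℂ) :=
  inferInstanceAs (BorelSpace (a → b → ℂ))

theorem continuous_wishartResolvent :
    Continuous (wishartResolvent : Matrix (Fin n) (Fin m) ℂ → _) := by
  have h : Continuous fun G : Matrix (Fin n) (Fin m) ℂ => 1 + G * G.conjTranspose := by fun_prop
  have h2 : (wishartResolvent : Matrix (Fin n) (Fin m) ℂ → _) = fun G =>
      ((1 + G * G.conjTranspose).det)⁻¹ • (1 + G * G.conjTranspose).adjugate := by
    ext1 G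
    rw [wishartResolvent, Matrix.inv_def, Ring.inverse_eq_inv']
  rw [h2]
  refine (h.matrix_det.inv₀ fun G => ?_).smul h.matrix_adjugate
  exact ((Matrix.isUnit_iff_isUnit_det _).1 (isUnit_one_add_mul_conjTranspose G)).ne_zero

theorem matrixTame_wishartResolvent :
    MatrixTame (wishartResolvent : Matrix (Fin n) (Fin m) ℂ → _) := fun i j =>
  ⟨(continuous_wishartResolvent.matrix_elem i j).measurable, 1,
    fun G => (norm_resolvent_le G i).1 j⟩

theorem matrixTame_wishartResolvent_mul :
    MatrixTame fun G : Matrix (Fin n) (Fin m) ℂ => wishartResolvent G * G := fun i j =>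
  ⟨((continuous_wishartResolvent.matrix_mul continuous_id).matrix_elem i j).measurable, 1,
    fun G => (norm_resolvent_le G i).2 j⟩

theorem matrixTame_pow_mul (k : ℕ) :
    MatrixTame fun G : Matrix (Fin n) (Fin m) ℂ => wishartResolvent G ^ (k + 1) * G := by
  simpa only [pow_succ, Matrix.mul_assoc] using
    (matrixTame_wishartResolvent.pow k).mul matrixTame_wishartResolvent_mul

theorem matrixTame_conjTranspose_mul_pow_mul (k : ℕ) :
    MatrixTame fun G : Matrix (Fin n) (Fin m) ℂ =>
      G.conjTranspose * wishartResolvent G ^ (k + 1) * G := by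
  cases k with
  | zero =>
    intro i j
    refine ⟨?_, 1, fun G => ?_⟩
    · simp only [zero_add, pow_one]
      exact (((continuous_id.matrix_conjTranspose.matrix_mul continuous_wishartResolvent).matrix_mul
        continuous_id).matrix_elem i j).measurable
    · simpa using norm_conjTranspose_mul_resolvent_mul_le G i j
  | succ k =>
    have h := (matrixTame_wishartResolvent_mul (n := n) (m := m)).conjTranspose.mul
      (matrixTame_pow_mul k)
    simp only [Matrix.conjTranspose_mul, resolvent_conjTranspose] at h
    simpa only [pow_succ' _ (k + 1), Matrix.mul_assoc] using h

end Tame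

section LoopEquation

variable {n m : ℕ}

theorem trace_mul_single_mul {a b c : Type*} [Fintype a] [Fintype b] [Fintype c] [DecidableEq b]
    [DecidableEq c] (X : Matrix a b ℂ) (Y : Matrix c a ℂ) (i : b) (j : c) (z : ℂ) :
    (X * Matrix.single i j z * Y).trace = z * (Y * X) j i := by
  simp only [Matrix.trace, Matrix.diag_apply, mul_single_mul_apply]
  rw [Matrix.mul_apply, Finset.mul_sum]
  exact Finset.sum_congr rfl fun _ _ => by ring

theorem hasDerivAt_trace_resolvent (G : Matrix (Fin n) (Fin m) ℂ) (i : Fin n) (j : Fin m) (z : ℂ) :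
    HasDerivAt (fun t : ℝ => (wishartResolvent (G + Matrix.single i j ((t : ℂ) * z))).trace)
      (-(z * (G.conjTranspose * wishartResolvent G ^ 2 : Matrix _ _ ℂ) j i +
        starRingEnd ℂ z * (wishartResolvent G ^ 2 * G : Matrix _ _ ℂ) i j)) 0 := by
  refine (hasMatrixDerivAt_resolvent G i j z).trace.congr_deriv ?_
  rw [Matrix.trace_neg, mul_add, add_mul, Matrix.trace_add, ← Matrix.mul_assoc, ← Matrix.mul_assoc,
    Matrix.mul_assoc _ G.conjTranspose, trace_mul_single_mul, trace_mul_single_mul, pow_two,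
    Matrix.mul_assoc, Matrix.mul_assoc]

theorem hasDerivAt_pow_resolvent_mul (G : Matrix (Fin n) (Fin m) ℂ) (k : ℕ) (i : Fin n) (j : Fin m)
    (z : ℂ) :
    HasDerivAt (fun t : ℝ => (wishartResolvent (G + Matrix.single i j ((t : ℂ) * z)) ^ (k + 1) *
        (G + Matrix.single i j ((t : ℂ) * z))) i j)
      (z * (wishartResolvent G ^ (k + 1)) i i - ∑ p ∈ Finset.range (k + 1),
        (z * ((wishartResolvent G ^ (p + 1)) i i *
          (G.conjTranspose * wishartResolvent G ^ (k - p + 1) * G) j j) +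
        starRingEnd ℂ z * ((wishartResolvent G ^ (p + 1) * G) i j *
          (wishartResolvent G ^ (k - p + 1) * G) i j))) 0 := by
  have h := (((hasMatrixDerivAt_resolvent G i j z).pow k).mul
    (hasMatrixDerivAt_add_single G i j z)) i j
  refine h.congr_deriv ?_
  simp only [Complex.ofReal_zero, zero_mul, Matrix.single_zero, add_zero, Matrix.add_apply,
    Matrix.sum_mul, Matrix.sum_apply]
  rw [Matrix.mul_single_apply_same, add_comm, sub_eq_add_neg, ← Finset.sum_neg_distrib,
    mul_comm z]
  congr 1
  refine Finset.sum_congr rfl fun p _ => ?_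
  set R := wishartResolvent G
  have e : R ^ p * -(R * (Matrix.single i j z * G.conjTranspose +
      G * Matrix.single j i (starRingEnd ℂ z)) * R) * R ^ (k - p) * G =
      -(R ^ (p + 1) * Matrix.single i j z * (G.conjTranspose * R ^ (k - p + 1) * G) +
        R ^ (p + 1) * G * Matrix.single j i (starRingEnd ℂ z) * (R ^ (k - p + 1) * G)) := by
    rw [pow_succ R p, pow_succ' R (k - p)]
    simp only [Matrix.mul_assoc, Matrix.mul_add, Matrix.add_mul, Matrix.mul_neg, Matrix.neg_mul]
  rw [e, Matrix.neg_apply, Matrix.add_apply, mul_single_mul_apply, mul_single_mul_apply]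
  ring

theorem integral_conj_entry_mul_resolvent (i : Fin n) (j : Fin m) (k a : ℕ) :
    ∫ G, starRingEnd ℂ (G i j) * ((wishartResolvent G ^ (k + 1) * G) i j *
        (wishartResolvent G).trace ^ a) ∂gaussMatrix n m =
      ∫ G, (((wishartResolvent G ^ (k + 1)) i i - ∑ p ∈ Finset.range (k + 1),
        (wishartResolvent G ^ (p + 1)) i i *
          (G.conjTranspose * wishartResolvent G ^ (k - p + 1) * G) j j) *
            (wishartResolvent G).trace ^ a -
        (wishartResolvent G ^ (k + 1) * G) i j * (a * (wishartResolvent G).trace ^ (a - 1) *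
          (G.conjTranspose * wishartResolvent G ^ 2 : Matrix _ _ ℂ) j i)) ∂gaussMatrix n m := by
  have tT := (matrixTame_wishartResolvent (n := n) (m := m)).trace
  have tR := fun q => (matrixTame_wishartResolvent (n := n) (m := m)).pow q
  have tRG := fun q => matrixTame_pow_mul (n := n) (m := m) q
  have tGRG := fun q => matrixTame_conjTranspose_mul_pow_mul (n := n) (m := m) q
  have tGR : MatrixTame fun G : Matrix (Fin n) (Fin m) ℂ =>
      G.conjTranspose * wishartResolvent G ^ 2 := by
    have h := (tRG 1).conjTranspose
    simpa only [Matrix.conjTranspose_mul, Matrix.conjTranspose_pow, resolvent_conjTranspose] using h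
  have tF := (tRG k i j).mul (tT.pow a)
  have tA := (((tR (k + 1) i i).sub (Tame.sum (Finset.range (k + 1)) fun p _ =>
      (tR (p + 1) i i).mul (tGRG (k - p) j j))).mul (tT.pow a)).sub
    ((tRG k i j).mul (((tame_const (a : ℂ)).mul (tT.pow (a - 1))).mul (tGR j i)))
  have tB := (((Tame.sum (Finset.range (k + 1)) fun p _ =>
      (tRG p i j).mul (tRG (k - p) i j))).mul (tT.pow a)).neg.sub
    ((tRG k i j).mul (((tame_const (a : ℂ)).mul (tT.pow (a - 1))).mul (tRG 1 i j)))
  obtain ⟨mF, C1, h1⟩ := tF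
  obtain ⟨mA, C2, h2⟩ := tA
  obtain ⟨mB, C3, h3⟩ := tB
  refine integral_conj_entry_mul i j (C := max C1 (max C2 C3)) mF mA mB ?_
    (fun G => (h1 G).trans (le_max_left _ _))
    (fun G => (h2 G).trans ((le_max_left _ _).trans (le_max_right _ _)))
    (fun G => (h3 G).trans ((le_max_right _ _).trans (le_max_right _ _)))
  intro G c
  refine ((hasDerivAt_pow_resolvent_mul G k i j c).mul
    ((hasDerivAt_trace_resolvent G i j c).fun_pow a)).congr_deriv ?_
  simp only [Complex.ofReal_zero, zero_mul, Matrix.single_zero, add_zero, Finset.sum_add_distrib,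
    ← Finset.mul_sum]
  ring

theorem trace_mul_eq_sum {a b : Type*} [Fintype a] [Fintype b] (X : Matrix a b ℂ)
    (Y : Matrix b a ℂ) : (X * Y).trace = ∑ i, ∑ j, X i j * Y j i := by
  simp only [Matrix.trace, Matrix.diag_apply, Matrix.mul_apply]

theorem loop_equation (k a : ℕ) :
    ∫ G, ((wishartResolvent G ^ k).trace - (wishartResolvent G ^ (k + 1)).trace) *
        (wishartResolvent G).trace ^ a ∂gaussMatrix n m =
      ∫ G, (((m : ℂ) * (wishartResolvent G ^ (k + 1)).trace - ∑ p ∈ Finset.range (k + 1),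
        (wishartResolvent G ^ (p + 1)).trace *
          ((wishartResolvent G ^ (k - p)).trace - (wishartResolvent G ^ (k - p + 1)).trace)) *
            (wishartResolvent G).trace ^ a -
        a * (wishartResolvent G).trace ^ (a - 1) * ((wishartResolvent G ^ (k + 2)).trace -
          (wishartResolvent G ^ (k + 3)).trace)) ∂gaussMatrix n m := by
  set R : Matrix (Fin n) (Fin m) ℂ → Matrix (Fin n) (Fin n) ℂ := wishartResolvent with hR
  have tT := (matrixTame_wishartResolvent (n := n) (m := m)).trace
  have tR := fun q => (matrixTame_wishartResolvent (n := n) (m := m)).pow q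
  have tRG := fun q => matrixTame_pow_mul (n := n) (m := m) q
  have tGRG := fun q => matrixTame_conjTranspose_mul_pow_mul (n := n) (m := m) q
  have tGR : MatrixTame fun G : Matrix (Fin n) (Fin m) ℂ => G.conjTranspose * R G ^ 2 := by
    have h := (tRG 1).conjTranspose
    simpa only [Matrix.conjTranspose_mul, Matrix.conjTranspose_pow, resolvent_conjTranspose] using h
  have hA : ∀ i j, Tame fun G : Matrix (Fin n) (Fin m) ℂ =>
      (((R G ^ (k + 1)) i i - ∑ p ∈ Finset.range (k + 1),
        (R G ^ (p + 1)) i i * (G.conjTranspose * R G ^ (k - p + 1) * G) j j) * (R G).trace ^ a -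
        (R G ^ (k + 1) * G) i j * (a * (R G).trace ^ (a - 1) *
          (G.conjTranspose * R G ^ 2 : Matrix _ _ ℂ) j i)) := fun i j =>
    (((tR (k + 1) i i).sub (Tame.sum (Finset.range (k + 1)) fun p _ =>
      (tR (p + 1) i i).mul (tGRG (k - p) j j))).mul (tT.pow a)).sub
    ((tRG k i j).mul (((tame_const (a : ℂ)).mul (tT.pow (a - 1))).mul (tGR j i)))
  have hF : ∀ i j, Integrable (fun G : Matrix (Fin n) (Fin m) ℂ =>
      starRingEnd ℂ (G i j) * ((R G ^ (k + 1) * G) i j * (R G).trace ^ a)) (gaussMatrix n m) := by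
    intro i j
    obtain ⟨hm, C, hC⟩ := (tRG k i j).mul (tT.pow a)
    exact (integrable_conj_entry i j).mul_bdd hm.aestronglyMeasurable (ae_of_all _ hC)
  have hL : ∀ G : Matrix (Fin n) (Fin m) ℂ,
      ((R G ^ k).trace - (R G ^ (k + 1)).trace) * (R G).trace ^ a =
        ∑ i, ∑ j, starRingEnd ℂ (G i j) * ((R G ^ (k + 1) * G) i j * (R G).trace ^ a) := by
    intro G
    rw [← Matrix.trace_sub, ← resolvent_pow_succ_mul, ← Matrix.mul_assoc, trace_mul_eq_sum,
      Finset.sum_mul]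
    refine Finset.sum_congr rfl fun i _ => ?_
    rw [Finset.sum_mul]
    refine Finset.sum_congr rfl fun j _ => ?_
    rw [Matrix.conjTranspose_apply, Complex.star_def]
    ring
  have hRR : ∀ G : Matrix (Fin n) (Fin m) ℂ,
      (((m : ℂ) * (R G ^ (k + 1)).trace - ∑ p ∈ Finset.range (k + 1),
        (R G ^ (p + 1)).trace * ((R G ^ (k - p)).trace - (R G ^ (k - p + 1)).trace)) *
            (R G).trace ^ a -
        a * (R G).trace ^ (a - 1) * ((R G ^ (k + 2)).trace - (R G ^ (k + 3)).trace)) =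
      ∑ i, ∑ j, (((R G ^ (k + 1)) i i - ∑ p ∈ Finset.range (k + 1),
        (R G ^ (p + 1)) i i * (G.conjTranspose * R G ^ (k - p + 1) * G) j j) * (R G).trace ^ a -
        (R G ^ (k + 1) * G) i j * (a * (R G).trace ^ (a - 1) *
          (G.conjTranspose * R G ^ 2 : Matrix _ _ ℂ) j i)) := by
    intro G
    have e1 : ∀ q : ℕ, (R G ^ q).trace - (R G ^ (q + 1)).trace =
        (G.conjTranspose * R G ^ (q + 1) * G).trace := by
      intro q
      rw [← Matrix.trace_sub, ← resolvent_pow_succ_mul, ← Matrix.mul_assoc, Matrix.trace_mul_comm,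
        ← Matrix.mul_assoc]
    have e2 : (R G ^ (k + 2)).trace - (R G ^ (k + 3)).trace =
        ((R G ^ (k + 1) * G) * (G.conjTranspose * R G ^ 2)).trace := by
      rw [e1, Matrix.trace_mul_comm (R G ^ (k + 1) * G), Matrix.mul_assoc, Matrix.mul_assoc,
        ← Matrix.mul_assoc (R G ^ 2), ← pow_add, show 2 + (k + 1) = k + 2 + 1 by ring]
    have e3 : ∀ p, ∑ i, ∑ j, (R G ^ (p + 1)) i i *
        (G.conjTranspose * R G ^ (k - p + 1) * G) j j =
        (R G ^ (p + 1)).trace * ((R G ^ (k - p)).trace - (R G ^ (k - p + 1)).trace) := by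
      intro p
      rw [e1, Matrix.trace, Matrix.trace, Finset.sum_mul_sum]
      rfl
    have e4 : ∑ i, ∑ _j : Fin m, (R G ^ (k + 1)) i i = (m : ℂ) * (R G ^ (k + 1)).trace := by
      simp [Matrix.trace, Finset.mul_sum]
    rw [e2, trace_mul_eq_sum, ← e4, Finset.sum_congr rfl fun p _ => (e3 p).symm]
    simp only [Finset.sum_sub_distrib, ← Finset.sum_mul]
    congr 2
    · congr 1
      rw [Finset.sum_comm]
      exact Finset.sum_congr rfl fun i _ => Finset.sum_comm
    · simp only [Finset.mul_sum]
      exact Finset.sum_congr rfl fun i _ => Finset.sum_congr rfl fun j _ => by ring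
  simp_rw [hL, hRR]
  rw [integral_finsetSum, integral_finsetSum]
  · refine Finset.sum_congr rfl fun i _ => ?_
    rw [integral_finsetSum, integral_finsetSum]
    · exact Finset.sum_congr rfl fun j _ => integral_conj_entry_mul_resolvent i j k a
    · exact fun j _ => (hA i j).integrable
    · exact fun j _ => hF i j
  · exact fun i _ => (Tame.sum _ fun j _ => hA i j).integrable
  · exact fun i _ => integrable_finsetSum _ fun j _ => hF i j

end LoopEquation

section ResolventTrace

variable {n m : ℕ}

theorem eigs_mul_conjTranspose_nonneg (G : Matrix (Fin n) (Fin m) ℂ) (i : Fin n) :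
    0 ≤ eigs (G * G.conjTranspose) i := by
  open scoped ComplexOrder in
  rw [eigs, dif_pos (Matrix.isHermitian_mul_conjTranspose_self G)]
  exact (Matrix.posSemidef_self_mul_conjTranspose G).eigenvalues_nonneg i

/-- The eigenvalues of the resolvent `(1 + G Gᴴ)⁻¹`. -/
def resolventEigs (G : Matrix (Fin n) (Fin m) ℂ) (i : Fin n) : ℝ :=
  (1 + eigs (G * G.conjTranspose) i)⁻¹

/-- The trace of the `k`-th power of the resolvent `(1 + G Gᴴ)⁻¹`. -/
def resolventTrace (G : Matrix (Fin n) (Fin m) ℂ) (k : ℕ) : ℝ := ∑ i, resolventEigs G i ^ k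

theorem resolventEigs_nonneg (G : Matrix (Fin n) (Fin m) ℂ) (i : Fin n) : 0 ≤ resolventEigs G i :=
  inv_nonneg.2 (by linarith [eigs_mul_conjTranspose_nonneg G i])

theorem resolventEigs_le_one (G : Matrix (Fin n) (Fin m) ℂ) (i : Fin n) : resolventEigs G i ≤ 1 :=
  inv_le_one_of_one_le₀ (by linarith [eigs_mul_conjTranspose_nonneg G i])

theorem trace_wishartResolvent_pow (G : Matrix (Fin n) (Fin m) ℂ) (k : ℕ) :
    (wishartResolvent G ^ k).trace = (resolventTrace G k : ℂ) := by
  have hH := Matrix.isHermitian_mul_conjTranspose_self G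
  set φ := Unitary.conjStarAlgAut ℂ (Matrix (Fin n) (Fin n) ℂ) hH.eigenvectorUnitary with hφ
  have hM : G * G.conjTranspose =
      φ (Matrix.diagonal fun i => (eigs (G * G.conjTranspose) i : ℂ)) := by
    rw [eigs, dif_pos hH]
    exact hH.spectral_theorem
  have hR : wishartResolvent G = φ (Matrix.diagonal fun i => (resolventEigs G i : ℂ)) := by
    refine Matrix.inv_eq_right_inv ?_
    conv_lhs => enter [1]; rw [hM, ← map_one φ, ← map_add]
    rw [← map_mul, ← Matrix.diagonal_one, Matrix.diagonal_add, Matrix.diagonal_mul_diagonal,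
      Matrix.diagonal_one]
    convert map_one φ
    rw [← Matrix.diagonal_one]
    congr 1
    ext i
    have h := eigs_mul_conjTranspose_nonneg G i
    rw [resolventEigs]
    norm_cast
    exact mul_inv_cancel₀ (by linarith)
  have htr : ∀ X, (φ X).trace = X.trace := by
    intro X
    rw [hφ, Unitary.conjStarAlgAut_apply, Matrix.trace_mul_comm, ← Matrix.mul_assoc,
      Unitary.coe_star_mul_self, Matrix.one_mul]
  rw [hR, ← map_pow, htr, Matrix.diagonal_pow, Matrix.trace_diagonal, resolventTrace]
  push_cast
  rfl

theorem resolventTrace_nonneg (G : Matrix (Fin n) (Fin m) ℂ) (k : ℕ) : 0 ≤ resolventTrace G k :=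
  Finset.sum_nonneg fun i _ => pow_nonneg (resolventEigs_nonneg G i) k

theorem resolventTrace_zero (G : Matrix (Fin n) (Fin m) ℂ) : resolventTrace G 0 = n := by
  simp [resolventTrace]

theorem resolventTrace_succ_le (G : Matrix (Fin n) (Fin m) ℂ) (k : ℕ) :
    resolventTrace G (k + 1) ≤ resolventTrace G k :=
  Finset.sum_le_sum fun i _ =>
    pow_le_pow_of_le_one (resolventEigs_nonneg G i) (resolventEigs_le_one G i) k.le_succ

theorem resolventTrace_le (G : Matrix (Fin n) (Fin m) ℂ) (k : ℕ) : resolventTrace G k ≤ n := by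
  induction k with
  | zero => rw [resolventTrace_zero]
  | succ k ih => exact (resolventTrace_succ_le G k).trans ih

theorem measurable_resolventTrace (k : ℕ) :
    Measurable fun G : Matrix (Fin n) (Fin m) ℂ => resolventTrace G k := by
  have h := Complex.measurable_re.comp
    ((matrixTame_wishartResolvent (n := n) (m := m)).pow k).trace.1
  simpa [Function.comp_def, trace_wishartResolvent_pow] using h

theorem sum_pow_mul_sum_pow_le {ι : Type*} [Fintype ι] {x : ι → ℝ} (hx : ∀ i, 0 ≤ x i) (p q : ℕ) :
    (∑ i, x i ^ (p + 1)) * ∑ i, x i ^ (q + 1) ≤ (∑ i, x i) * ∑ i, x i ^ (p + q + 1) := by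
  have key : ∀ i j, x i ^ (p + 1) * x j ^ (q + 1) + x j ^ (p + 1) * x i ^ (q + 1) ≤
      x i * x j ^ (p + q + 1) + x j * x i ^ (p + q + 1) := by
    intro i j
    have h : 0 ≤ (x i ^ p - x j ^ p) * (x i ^ q - x j ^ q) := by
      rcases le_total (x i) (x j) with h | h
      · exact mul_nonneg_of_nonpos_of_nonpos (sub_nonpos.2 (pow_le_pow_left₀ (hx i) h p))
          (sub_nonpos.2 (pow_le_pow_left₀ (hx i) h q))
      · exact mul_nonneg (sub_nonneg.2 (pow_le_pow_left₀ (hx j) h p))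
          (sub_nonneg.2 (pow_le_pow_left₀ (hx j) h q))
    have h2 := mul_nonneg (mul_nonneg (hx i) (hx j)) h
    have e : x i * x j * ((x i ^ p - x j ^ p) * (x i ^ q - x j ^ q)) =
        x i * x j ^ (p + q + 1) + x j * x i ^ (p + q + 1) -
          (x i ^ (p + 1) * x j ^ (q + 1) + x j ^ (p + 1) * x i ^ (q + 1)) := by ring
    linarith
  have h := Finset.sum_le_sum fun i (_ : i ∈ Finset.univ) =>
    Finset.sum_le_sum fun j (_ : j ∈ Finset.univ) => key i j
  simp only [Finset.sum_add_distrib] at h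
  rw [Finset.sum_mul_sum, Finset.sum_mul_sum]
  rw [Finset.sum_comm (f := fun i j => x j ^ (p + 1) * x i ^ (q + 1)),
    Finset.sum_comm (f := fun i j => x j * x i ^ (p + q + 1))] at h
  linarith

/-- The mixed moments `E[T₁ᵃ Tₖ]` of resolvent traces. -/
def resolventMoment (n m a k : ℕ) : ℝ :=
  ∫ G, resolventTrace G 1 ^ a * resolventTrace G k ∂gaussMatrix n m

theorem integrable_resolventTrace_pow_mul (a k : ℕ) :
    Integrable (fun G : Matrix (Fin n) (Fin m) ℂ => resolventTrace G 1 ^ a * resolventTrace G k)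
      (gaussMatrix n m) := by
  refine Integrable.of_bound (((measurable_resolventTrace 1).pow_const a).mul
    (measurable_resolventTrace k)).aestronglyMeasurable ((n : ℝ) ^ a * n) (.of_forall fun G => ?_)
  rw [Real.norm_eq_abs, abs_of_nonneg (mul_nonneg (pow_nonneg (resolventTrace_nonneg G 1) a)
    (resolventTrace_nonneg G k))]
  exact mul_le_mul (pow_le_pow_left₀ (resolventTrace_nonneg G 1) (resolventTrace_le G 1) a)
    (resolventTrace_le G k) (resolventTrace_nonneg G k) (by positivity)

theorem resolventMoment_nonneg (n m a k : ℕ) : 0 ≤ resolventMoment n m a k :=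
  integral_nonneg fun G => mul_nonneg (pow_nonneg (resolventTrace_nonneg G 1) a)
    (resolventTrace_nonneg G k)

theorem resolventMoment_zero_zero (n m : ℕ) : resolventMoment n m 0 0 = n := by
  simp [resolventMoment, resolventTrace_zero]

theorem resolventMoment_succ_zero (n m a : ℕ) :
    resolventMoment n m (a + 1) 0 = n * resolventMoment n m a 1 := by
  simp only [resolventMoment, resolventTrace_zero]
  rw [← integral_const_mul]
  congr 1
  ext G
  ring

theorem loop_equation_real (k a : ℕ) :
    ∫ G, (resolventTrace G k - resolventTrace G (k + 1)) * resolventTrace G 1 ^ a ∂gaussMatrix n m =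
      ∫ G, ((m * resolventTrace G (k + 1) - ∑ p ∈ Finset.range (k + 1),
        resolventTrace G (p + 1) * (resolventTrace G (k - p) - resolventTrace G (k - p + 1))) *
            resolventTrace G 1 ^ a -
        a * resolventTrace G 1 ^ (a - 1) * (resolventTrace G (k + 2) -
          resolventTrace G (k + 3))) ∂gaussMatrix n m := by
  have h := loop_equation (n := n) (m := m) k a
  have e : ∀ G : Matrix (Fin n) (Fin m) ℂ,
      (wishartResolvent G).trace = (resolventTrace G 1 : ℂ) := fun G => by
    rw [← trace_wishartResolvent_pow, pow_one]
  simp only [trace_wishartResolvent_pow, e] at h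
  rw [← Complex.ofReal_inj, ← integral_complex_ofReal, ← integral_complex_ofReal]
  push_cast
  exact h

theorem resolventMoment_recursion {D : ℝ} (hD : (n : ℝ) + D ≤ m) (a k : ℕ) :
    D * resolventMoment n m a (k + 1) ≤
      resolventMoment n m a k + k * resolventMoment n m (a + 1) k +
      a * resolventMoment n m (a - 1) (k + 1) := by
  have hI := fun a k => integrable_resolventTrace_pow_mul (n := n) (m := m) a k
  have hI_sq : Integrable (fun G : Matrix (Fin n) (Fin m) ℂ =>
      (m * resolventTrace G (k + 1) - ∑ p ∈ Finset.range (k + 1),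
        resolventTrace G (p + 1) * (resolventTrace G (k - p) - resolventTrace G (k - p + 1))) *
            resolventTrace G 1 ^ a -
        a * resolventTrace G 1 ^ (a - 1) * (resolventTrace G (k + 2) -
          resolventTrace G (k + 3))) (gaussMatrix n m) := by
    have hT : ∀ k, Tame fun G : Matrix (Fin n) (Fin m) ℂ => (resolventTrace G k : ℂ) := fun k => by
      simpa only [trace_wishartResolvent_pow] using (matrixTame_wishartResolvent.pow k).trace
    have h := ((((tame_const (m : ℂ)).mul (hT (k + 1))).sub (Tame.sum (Finset.range (k + 1))
      fun p _ => (hT (p + 1)).mul ((hT (k - p)).sub (hT (k - p + 1))))).mul ((hT 1).pow a)).sub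
      (((tame_const (a : ℂ)).mul ((hT 1).pow (a - 1))).mul ((hT (k + 2)).sub (hT (k + 3))))
    refine h.integrable.re.congr (.of_forall fun G => ?_)
    simp only [RCLike.re_to_complex]
    norm_cast
  have key : ∀ G : Matrix (Fin n) (Fin m) ℂ,
      D * (resolventTrace G 1 ^ a * resolventTrace G (k + 1)) -
          k * (resolventTrace G 1 ^ (a + 1) * resolventTrace G k) -
          a * (resolventTrace G 1 ^ (a - 1) * resolventTrace G (k + 1)) ≤
      (m * resolventTrace G (k + 1) - ∑ p ∈ Finset.range (k + 1),
        resolventTrace G (p + 1) * (resolventTrace G (k - p) - resolventTrace G (k - p + 1))) *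
            resolventTrace G 1 ^ a -
        a * resolventTrace G 1 ^ (a - 1) * (resolventTrace G (k + 2) -
          resolventTrace G (k + 3)) := by
    intro G
    set T := resolventTrace G with hT
    have hT0 : ∀ k, 0 ≤ T k := resolventTrace_nonneg G
    have hTs : ∀ k, T (k + 1) ≤ T k := resolventTrace_succ_le G
    have hsum : ∑ p ∈ Finset.range (k + 1), T (p + 1) * (T (k - p) - T (k - p + 1)) ≤
        k * (T 1 * T k) + T (k + 1) * n := by
      rw [Finset.sum_range_succ]
      refine add_le_add ?_ ?_
      · calc _ ≤ ∑ p ∈ Finset.range k, T 1 * T k := by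
              refine Finset.sum_le_sum fun p hp => ?_
              obtain ⟨q, rfl⟩ := Nat.exists_eq_add_of_lt (Finset.mem_range.1 hp)
              have h := sum_pow_mul_sum_pow_le (resolventEigs_nonneg G) p q
              calc _ ≤ T (p + 1) * T (q + 1) := by
                    refine mul_le_mul_of_nonneg_left ?_ (hT0 _)
                    rw [show p + q + 1 - p = q + 1 by omega]
                    linarith [hT0 (q + 1 + 1)]
                _ ≤ _ := by simpa [hT, resolventTrace] using h
          _ = _ := by simp
      · refine mul_le_mul_of_nonneg_left ?_ (hT0 _)
        have h0 : T 0 = n := resolventTrace_zero G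
        simp only [tsub_self, h0]
        linarith [hT0 (0 + 1)]
    have h1 : D * T (k + 1) - k * (T 1 * T k) ≤ m * T (k + 1) -
        ∑ p ∈ Finset.range (k + 1), T (p + 1) * (T (k - p) - T (k - p + 1)) := by
      nlinarith [mul_le_mul_of_nonneg_right hD (hT0 (k + 1))]
    have h2 := mul_le_mul_of_nonneg_right h1 (pow_nonneg (hT0 1) a)
    have h3 : (a * T 1 ^ (a - 1)) * (T (k + 2) - T (k + 3)) ≤ (a * T 1 ^ (a - 1)) * T (k + 1) :=
      mul_le_mul_of_nonneg_left (by linarith [hT0 (k + 3), hTs (k + 1)])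
        (mul_nonneg (Nat.cast_nonneg a) (pow_nonneg (hT0 1) _))
    rw [pow_succ]
    linarith
  have h := integral_mono ((((hI a (k + 1)).const_mul D).sub ((hI (a + 1) k).const_mul k)).sub
    ((hI (a - 1) (k + 1)).const_mul a)) hI_sq key
  rw [← loop_equation_real] at h
  have h4 : ∫ G, (resolventTrace G k - resolventTrace G (k + 1)) * resolventTrace G 1 ^ a
      ∂gaussMatrix n m ≤ resolventMoment n m a k := by
    refine integral_mono ?_ (hI a k) fun G => ?_
    · refine ((hI a k).sub (hI a (k + 1))).congr (.of_forall fun G => ?_)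
      simp only [Pi.sub_apply]
      ring
    · have := mul_nonneg (resolventTrace_nonneg G (k + 1))
        (pow_nonneg (resolventTrace_nonneg G 1) a)
      simp only
      linarith
  rw [integral_sub' (((hI a (k + 1)).const_mul D).sub ((hI (a + 1) k).const_mul k))
    ((hI (a - 1) (k + 1)).const_mul a), integral_sub' ((hI a (k + 1)).const_mul D)
    ((hI (a + 1) k).const_mul k), integral_const_mul, integral_const_mul, integral_const_mul] at h
  have h5 := h.trans h4
  simp only [resolventMoment] at h5 ⊢
  linarith

theorem moment_bound {F : ℕ → ℕ → ℝ} {D : ℝ} {n N : ℕ} (hD : 0 < D) (hDN : D ≤ 2 * n * N)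
    (hNn : N ≤ n) (hF : ∀ a k, 0 ≤ F a k) (h00 : F 0 0 = n) (h0 : ∀ a, F (a + 1) 0 = n * F a 1)
    (hrec : ∀ a k, D * F a (k + 1) ≤ F a k + k * F (a + 1) k + a * F (a - 1) (k + 1))
    (k a : ℕ) (hak : a + k + 1 ≤ N) :
    F a (k + 1) ≤ (2 * n / D) ^ (a + 1) * (4 * N * (2 * n / D) / D) ^ k := by
  have hN : (1 : ℝ) ≤ N := by exact_mod_cast (show 1 ≤ N by omega)
  have hn : (1 : ℝ) ≤ n := hN.trans (by exact_mod_cast hNn)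
  have hw : 0 < 2 * n / D := by positivity
  have hDw : D * (2 * n / D) = 2 * n := by field_simp
  have hNw : 1 ≤ N * (2 * n / D) := by
    rw [mul_div_assoc', le_div_iff₀ hD]
    linarith
  set w := 2 * n / D with hwd
  have hθ : 0 < 4 * N * w / D := by positivity
  have hDθ : D * (4 * N * w / D) = 4 * N * w := by field_simp
  set θ := 4 * N * w / D
  induction k generalizing a with
  | zero =>
    rw [pow_zero, mul_one]
    induction a with
    | zero =>
      have h := hrec 0 0
      rw [h00] at h
      simp only [CharP.cast_eq_zero, zero_mul, add_zero, zero_add, pow_one] at h ⊢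
      refine le_of_mul_le_mul_left ?_ hD
      linarith
    | succ a ih =>
      have h := hrec (a + 1) 0
      rw [h0] at h
      simp only [CharP.cast_eq_zero, zero_mul, add_zero, add_tsub_cancel_right, zero_add] at h ih ⊢
      have ha : ((a + 1 : ℕ) : ℝ) ≤ n := by exact_mod_cast (show a + 1 ≤ n by omega)
      have h1 := mul_le_mul_of_nonneg_right ha (hF a 1)
      have h2 := mul_le_mul_of_nonneg_left (ih (by omega)) hw.le
      refine le_of_mul_le_mul_left ?_ hD
      calc D * F (a + 1) 1 ≤ 2 * n * F a 1 := by linarith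
        _ = D * (w * F a 1) := by rw [← hDw]; ring
        _ ≤ D * (w * w ^ (a + 1)) := mul_le_mul_of_nonneg_left h2 hD.le
        _ = _ := by ring
  | succ k ih =>
    have hk : ((k + 1 : ℕ) : ℝ) ≤ N := by exact_mod_cast (show k + 1 ≤ N by omega)
    have hfin : ∀ a : ℕ, a ≤ n → 1 + (k + 1 : ℕ) * w + a * (4 * N * w / D) / w ≤ D * θ := by
      intro a ha
      have e : a * (4 * N * w / D) / w = 4 * N * a / D := by field_simp
      have h1 : 4 * N * a / D ≤ 2 * N * w := by
        rw [hwd, mul_div_assoc', div_le_div_iff_of_pos_right hD]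
        have : (a : ℝ) ≤ n := by exact_mod_cast ha
        nlinarith
      rw [e, hDθ]
      nlinarith [mul_le_mul_of_nonneg_right hk hw.le]
    induction a with
    | zero =>
      have h := hrec 0 (k + 1)
      have h1 := ih 0 (by omega)
      have h2 := ih 1 (by omega)
      have h3 := hfin 0 (by omega)
      simp only [CharP.cast_eq_zero, zero_mul, zero_div, add_zero, zero_add, pow_one] at h h1 h3 ⊢
      refine le_of_mul_le_mul_left ?_ hD
      calc D * F 0 (k + 1 + 1) ≤ F 0 (k + 1) + (k + 1 : ℕ) * F 1 (k + 1) := h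
        _ ≤ w * θ ^ k + (k + 1 : ℕ) * (w ^ (1 + 1) * θ ^ k) := by gcongr
        _ = (1 + (k + 1 : ℕ) * w) * (w * θ ^ k) := by ring
        _ ≤ (D * θ) * (w * θ ^ k) := by gcongr
        _ = _ := by ring
    | succ a iha =>
      have h := hrec (a + 1) (k + 1)
      have h1 := ih (a + 1) (by omega)
      have h2 := ih (a + 2) (by omega)
      have h3 := hfin (a + 1) (by omega)
      have h4 := iha (by omega)
      simp only [add_tsub_cancel_right] at h
      refine le_of_mul_le_mul_left ?_ hD
      calc D * F (a + 1) (k + 1 + 1) ≤ F (a + 1) (k + 1) + (k + 1 : ℕ) * F (a + 2) (k + 1) +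
            (a + 1 : ℕ) * F a (k + 1 + 1) := h
        _ ≤ w ^ (a + 1 + 1) * θ ^ k + (k + 1 : ℕ) * (w ^ (a + 2 + 1) * θ ^ k) +
            (a + 1 : ℕ) * (w ^ (a + 1) * θ ^ (k + 1)) := by gcongr
        _ = (1 + (k + 1 : ℕ) * w + (a + 1 : ℕ) * θ / w) * (w ^ (a + 1 + 1) * θ ^ k) := by
            field_simp
            ring
        _ ≤ (D * θ) * (w ^ (a + 1 + 1) * θ ^ k) := by gcongr
        _ = _ := by ring

end ResolventTrace

theorem resolventTrace_tail_bound {n m N : ℕ} {D : ℝ} (hD : 0 < D) (hnm : (n : ℝ) + D ≤ m)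
    (hDN : D ≤ 2 * n * (N + 1 : ℕ)) (hNn : N + 1 ≤ n) {c : ℝ} (hc : 0 < c) :
    (gaussMatrix n m).real {G | (c⁻¹) ^ (N + 1) ≤ resolventTrace G (N + 1)} ≤
      c * (2 * n / D) * (c * (4 * (N + 1 : ℕ) * (2 * n / D) / D)) ^ N := by
  have hF := moment_bound (F := resolventMoment n m) hD hDN hNn (resolventMoment_nonneg n m)
    (resolventMoment_zero_zero n m) (resolventMoment_succ_zero n m)
    (resolventMoment_recursion hnm) N 0 (by omega)
  have hM := mul_meas_ge_le_integral_of_nonneg (μ := gaussMatrix n m)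
    (f := fun G => resolventTrace G (N + 1)) (.of_forall fun G => resolventTrace_nonneg G _)
    (by simpa using integrable_resolventTrace_pow_mul (n := n) (m := m) 0 (N + 1))
    ((c⁻¹) ^ (N + 1))
  have e : ∫ G, resolventTrace G (N + 1) ∂gaussMatrix n m = resolventMoment n m 0 (N + 1) := by
    simp [resolventMoment]
  rw [e, inv_pow] at hM
  have h := (inv_mul_le_iff₀ (by positivity)).1 (hM.trans hF)
  rw [← inv_pow] at h
  refine h.trans_eq ?_
  rw [mul_pow]
  ring

theorem exists_eigs_lower_bound {c : ℝ} (hc : 1 ≤ c) {n m : ℕ}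
    (hm : (n : ℝ) + 24 * c * Real.exp 2 * √(n * Real.log n) ≤ m)
    (hn : 24 * c * Real.exp 2 ≤ n) :
    ∃ S : Set (Matrix (Fin n) (Fin m) ℂ), MeasurableSet S ∧ 1 / 2 ≤ (gaussMatrix n m).real S ∧
      ∀ G ∈ S, ∀ i, c ≤ 1 + eigs (G * G.conjTranspose) i := by
  set C := 24 * c * Real.exp 2 with hC
  have he : 1 ≤ Real.exp 2 := Real.one_le_exp (by norm_num)
  have hcC : 24 * c ≤ C := le_mul_of_one_le_right (by linarith) he
  have hn24 : (24 : ℝ) ≤ n := by linarith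
  have hn0 : (0 : ℝ) < n := by linarith
  have hlog1 : 1 ≤ Real.log n := by
    rw [Real.le_log_iff_exp_le hn0]
    linarith [Real.exp_one_lt_d9]
  set K := ⌈Real.log n⌉₊ with hK
  have hKl : Real.log n ≤ K := Nat.le_ceil _
  have hKu : (K : ℝ) < Real.log n + 1 := Nat.ceil_lt_add_one (by linarith)
  have hlogn : Real.log n ≤ n - 2 := by
    have h1 : Real.log n = 2 * Real.log √n := by
      rw [Real.log_sqrt hn0.le]; ring
    have h2 : Real.log √n ≤ √n - 1 := Real.log_le_sub_one_of_pos (Real.sqrt_pos.2 hn0)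
    have h3 : √n * √n = n := Real.mul_self_sqrt hn0.le
    have h4 : 2 ≤ √n := Real.le_sqrt_of_sq_le (by linarith)
    nlinarith
  have hKn : K + 1 ≤ n := by
    have : (K : ℝ) < n := by linarith
    exact_mod_cast this
  have hnl : n ≤ n * Real.log n := le_mul_of_one_le_right hn0.le hlog1
  set D := √(C * (n * Real.log n)) with hD
  have hpos : 0 < C * (n * Real.log n) := by positivity
  have hD0 : 0 < D := Real.sqrt_pos.2 hpos
  have hDD : D * D = C * (n * Real.log n) := Real.mul_self_sqrt hpos.le
  have hDm : (n : ℝ) + D ≤ m := by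
    refine le_trans ?_ hm
    rw [hD, Real.sqrt_mul (by linarith)]
    have : √C ≤ C := (Real.sqrt_le_left (by linarith)).2 (by nlinarith)
    gcongr
  have hDN : D ≤ 2 * n * (K + 1 : ℕ) := by
    refine (Real.sqrt_le_left (by positivity)).2 ?_
    push_cast
    have h1 : C * (n * Real.log n) ≤ (n * K) * (n * K) := by
      calc C * (n * Real.log n) ≤ n * (n * K) := by gcongr
        _ ≤ (n * K) * (n * K) := by
          gcongr
          exact le_mul_of_one_le_right hn0.le (by linarith)
    nlinarith [mul_nonneg hn0.le (Nat.cast_nonneg (α := ℝ) K)]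
  have hmain := resolventTrace_tail_bound hD0 hDm hDN hKn (c := c) (by linarith)
  have hw : 2 * n / D ≤ n := by
    rw [div_le_iff₀ hD0]
    have : 2 ≤ D := Real.le_sqrt_of_sq_le (by nlinarith)
    nlinarith
  have hθ : c * (4 * (K + 1 : ℕ) * (2 * n / D) / D) ≤ Real.exp (-2) := by
    have e1 : c * (4 * (K + 1 : ℕ) * (2 * n / D) / D) = 8 * c * (K + 1 : ℕ) * n / (D * D) := by
      field_simp
      ring
    rw [e1, hDD, Real.exp_neg, div_le_iff₀ hpos, hC]
    have e2 : (Real.exp 2)⁻¹ * (24 * c * Real.exp 2 * (n * Real.log n)) =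
        8 * c * (3 * Real.log n) * n := by field_simp; ring
    rw [e2]
    gcongr
    push_cast
    linarith
  have hsmall : (gaussMatrix n m).real {G | (c⁻¹) ^ (K + 1) ≤ resolventTrace G (K + 1)} ≤
      1 / 2 := by
    refine hmain.trans ?_
    have h1 : (c * (4 * (K + 1 : ℕ) * (2 * n / D) / D)) ^ K ≤ ((n : ℝ) ^ 2)⁻¹ := by
      refine (pow_le_pow_left₀ (by positivity) hθ K).trans ?_
      rw [← Real.exp_nat_mul, ← Real.exp_log hn0, ← Real.exp_nat_mul, ← Real.exp_neg,
        Real.exp_le_exp]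
      push_cast
      linarith
    calc _ ≤ c * n * ((n : ℝ) ^ 2)⁻¹ := by gcongr
      _ = c / n := by field_simp
      _ ≤ 1 / 2 := by rw [div_le_iff₀ hn0]; linarith
  refine ⟨{G | resolventTrace G (K + 1) < (c⁻¹) ^ (K + 1)},
    measurableSet_lt (measurable_resolventTrace _) measurable_const, ?_, fun G hG i => ?_⟩
  · have h := probReal_add_probReal_compl (μ := gaussMatrix n m)
      (measurableSet_le (f := fun _ => (c⁻¹) ^ (K + 1)) measurable_const
        (measurable_resolventTrace (n := n) (m := m) (K + 1)))
    rw [Set.compl_ofPred] at h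
    simp only [not_le] at h
    linarith
  · have h1 : resolventEigs G i ^ (K + 1) ≤ resolventTrace G (K + 1) :=
      Finset.single_le_sum (f := fun i => resolventEigs G i ^ (K + 1))
        (fun i _ => pow_nonneg (resolventEigs_nonneg G i) _) (Finset.mem_univ i)
    have h2 := lt_of_pow_lt_pow_left₀ _ (by positivity) (h1.trans_lt hG)
    exact ((inv_lt_inv₀ (by linarith [eigs_mul_conjTranspose_nonneg G i]) (by linarith)).1 h2).le

section TailSum

variable {n : ℕ}

theorem sortDesc_antitone (v : Fin n → ℝ) : Antitone (sortDesc v) :=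
  fun _ _ hij => Tuple.monotone_sort v (Fin.rev_le_rev.2 hij)

theorem sortDesc_zero : sortDesc (0 : Fin n → ℝ) = 0 := rfl

/-- The permutation sorting a tuple in decreasing order. -/
def descPerm (v : Fin n → ℝ) : Equiv.Perm (Fin n) := Fin.revPerm.trans (Tuple.sort v)

theorem sortDesc_apply (v : Fin n → ℝ) (i : Fin n) : sortDesc v i = v (descPerm v i) := rfl

theorem card_filter_le (k : Fin n) : (Finset.univ.filter fun i => k ≤ i).card = n - k := by
  rw [← Fin.card_Ici]
  congr 1
  ext i
  simp

theorem tailSum_sortDesc_le {v p : Fin n → ℝ} {k : Fin n} (h0 : ∀ i, 0 ≤ p i) (h1 : ∀ i, p i ≤ 1)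
    (hs : ∑ i, p i = (n - k : ℕ)) : tailSum (sortDesc v) k ≤ ∑ i, p i * v i := by
  have e : ∑ i, p (descPerm v i) * sortDesc v i = ∑ i, p i * v i :=
    Equiv.sum_comp (descPerm v) fun i => p i * v i
  have e1 : ∑ i, p (descPerm v i) = (n - k : ℕ) := by rw [Equiv.sum_comp (descPerm v) p, hs]
  have e2 : ∑ i : Fin n, (if k ≤ i then (1 : ℝ) else 0) = (n - k : ℕ) := by
    rw [Finset.sum_boole, card_filter_le]
  have e3 : tailSum (sortDesc v) k = ∑ i, (if k ≤ i then (1 : ℝ) else 0) * sortDesc v i := by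
    simp [tailSum, Finset.sum_filter]
  have key : 0 ≤ ∑ i, (p (descPerm v i) - if k ≤ i then (1 : ℝ) else 0) *
      (sortDesc v i - sortDesc v k) := by
    refine Finset.sum_nonneg fun i _ => ?_
    split_ifs with h
    · exact mul_nonneg_of_nonpos_of_nonpos (sub_nonpos.2 (h1 _))
        (sub_nonpos.2 (sortDesc_antitone v h))
    · exact mul_nonneg (by simpa using h0 _)
        (sub_nonneg.2 (sortDesc_antitone v (le_of_not_ge h)))
  simp only [sub_mul, mul_sub, Finset.sum_sub_distrib, ← Finset.sum_mul] at key
  rw [e1, e2, e, ← e3] at key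
  linarith

theorem tailSum_sortDesc_eq (v : Fin n → ℝ) (k : Fin n) :
    tailSum (sortDesc v) k = ∑ i, (if k ≤ (descPerm v).symm i then v i else 0) := by
  rw [← Equiv.sum_comp (descPerm v), tailSum, Finset.sum_filter]
  simp [sortDesc_apply]

theorem tailSum_sortDesc_zero (v : Fin n → ℝ) (k : Fin n) (hk : ∀ i, k ≤ i) :
    tailSum (sortDesc v) k = ∑ i, v i := by
  rw [tailSum_sortDesc_eq]
  exact Finset.sum_congr rfl fun i _ => if_pos (hk _)

theorem le_tailSum_sortDesc {v : Fin n → ℝ} {c : ℝ} (hc : 0 ≤ c) (hv : ∀ i, c ≤ v i) (k : Fin n) :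
    c ≤ tailSum (sortDesc v) k :=
  (hv _).trans (Finset.single_le_sum (f := sortDesc v) (fun _ _ => hc.trans (hv _))
    (Finset.mem_filter.2 ⟨Finset.mem_univ k, le_rfl⟩))

theorem tailSum_sortDesc_anti {v : Fin n → ℝ} (hv : ∀ i, 0 ≤ v i) :
    Antitone (tailSum (sortDesc v)) := fun _ _ hkl =>
  Finset.sum_le_sum_of_subset_of_nonneg
    (Finset.monotone_filter_right _ fun _ _ h => hkl.trans h) fun _ _ _ => hv _

end TailSum

section KyFan

variable {n m : ℕ}

/-- Orthogonal projections of rank `r`. -/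
structure IsRankProjection (P : Matrix (Fin n) (Fin n) ℂ) (r : ℕ) : Prop where
  conjTranspose : P.conjTranspose = P
  mul_self : P * P = P
  trace : P.trace = r

theorem IsRankProjection.diag_re {P : Matrix (Fin n) (Fin n) ℂ} {r : ℕ}
    (hP : IsRankProjection P r) (i : Fin n) :
    P i i = ((P i i).re : ℂ) ∧ 0 ≤ (P i i).re ∧ (P i i).re ≤ 1 := by
  have h1 : P i i = ((P i i).re : ℂ) := by
    have h := congrFun (congrFun hP.conjTranspose i) i
    exact (Complex.conj_eq_iff_re.1 h).symm
  have h2 : (P i i).re = ∑ j, ‖P i j‖ ^ 2 := by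
    have h : P i i = (P * P.conjTranspose) i i := by rw [hP.conjTranspose, hP.mul_self]
    conv_lhs => rw [h]
    simp only [Matrix.mul_apply, Matrix.conjTranspose_apply, Complex.star_def,
      Complex.mul_conj', Complex.re_sum]
    norm_cast
  have h3 : ‖P i i‖ ^ 2 ≤ (P i i).re := h2 ▸
    Finset.single_le_sum (f := fun j => ‖P i j‖ ^ 2) (fun _ _ => sq_nonneg _) (Finset.mem_univ i)
  have h4 := Complex.re_le_norm (P i i)
  exact ⟨h1, (sq_nonneg _).trans h3, by nlinarith [norm_nonneg (P i i)]⟩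

theorem IsRankProjection.map {P : Matrix (Fin n) (Fin n) ℂ} {r : ℕ} (hP : IsRankProjection P r)
    (U : Matrix.unitaryGroup (Fin n) ℂ) :
    IsRankProjection (Unitary.conjStarAlgAut ℂ _ U P) r := by
  refine ⟨?_, ?_, ?_⟩
  · rw [← Matrix.star_eq_conjTranspose, ← map_star, Matrix.star_eq_conjTranspose, hP.conjTranspose]
  · rw [← map_mul, hP.mul_self]
  · rw [Unitary.conjStarAlgAut_apply, Matrix.trace_mul_comm, ← Matrix.mul_assoc,
      Unitary.coe_star_mul_self, Matrix.one_mul, hP.trace]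

theorem exists_conjStarAlgAut_eigs {A : Matrix (Fin n) (Fin n) ℂ} (hA : A.IsHermitian) :
    ∃ U : Matrix.unitaryGroup (Fin n) ℂ,
      A = Unitary.conjStarAlgAut ℂ _ U (Matrix.diagonal fun i => (eigs A i : ℂ)) := by
  refine ⟨hA.eigenvectorUnitary, ?_⟩
  rw [eigs, dif_pos hA]
  exact hA.spectral_theorem

theorem trace_conjStarAlgAut (U : Matrix.unitaryGroup (Fin n) ℂ) (X : Matrix (Fin n) (Fin n) ℂ) :
    (Unitary.conjStarAlgAut ℂ _ U X).trace = X.trace := by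
  rw [Unitary.conjStarAlgAut_apply, Matrix.trace_mul_comm, ← Matrix.mul_assoc,
    Unitary.coe_star_mul_self, Matrix.one_mul]

/-- Ky Fan's minimum principle: lower bound. -/
theorem tailSum_eigsDesc_le {A P : Matrix (Fin n) (Fin n) ℂ} (hA : A.IsHermitian) {k : Fin n}
    (hP : IsRankProjection P (n - k)) : tailSum (eigsDesc A) k ≤ (P * A).trace.re := by
  obtain ⟨U, hU⟩ := exists_conjStarAlgAut_eigs hA
  have hQ := hP.map U⁻¹
  set Q := Unitary.conjStarAlgAut ℂ _ U⁻¹ P with hQd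
  have hPQ : P = Unitary.conjStarAlgAut ℂ _ U Q := by
    rw [hQd, ← Unitary.conjStarAlgAut_mul_apply]
    simp
  have e : (P * A).trace.re = ∑ i, (Q i i).re * eigs A i := by
    conv_lhs => rw [hU, hPQ, ← map_mul, trace_conjStarAlgAut]
    simp [Matrix.trace, Matrix.mul_diagonal]
  rw [e]
  refine tailSum_sortDesc_le (fun i => (hQ.diag_re i).2.1) (fun i => (hQ.diag_re i).2.2) ?_
  rw [← Complex.re_sum]
  have h := congrArg Complex.re hQ.trace
  simpa [Matrix.trace] using h

/-- Ky Fan's minimum principle: the minimum is attained. -/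
theorem exists_tailSum_eigsDesc_eq {A : Matrix (Fin n) (Fin n) ℂ} (hA : A.IsHermitian)
    (k : Fin n) :
    ∃ P, IsRankProjection P (n - k) ∧ (P * A).trace.re = tailSum (eigsDesc A) k := by
  obtain ⟨U, hU⟩ := exists_conjStarAlgAut_eigs hA
  set s : Fin n → ℂ := fun i => if k ≤ (descPerm (eigs A)).symm i then 1 else 0 with hs
  have hd : IsRankProjection (Matrix.diagonal s) (n - k) := by
    refine ⟨?_, ?_, ?_⟩
    · rw [Matrix.diagonal_conjTranspose]
      congr 1
      ext1 i
      simp only [Pi.star_apply, hs]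
      split_ifs <;> simp
    · rw [Matrix.diagonal_mul_diagonal]
      congr 1
      ext1 i
      simp only [hs]
      split_ifs <;> simp
    · rw [Matrix.trace_diagonal, ← Equiv.sum_comp (descPerm (eigs A))]
      simp only [hs, Equiv.symm_apply_apply]
      rw [Finset.sum_boole, card_filter_le]
  refine ⟨_, hd.map U, ?_⟩
  conv_lhs => enter [1, 1, 2]; rw [hU]
  rw [← map_mul, trace_conjStarAlgAut, Matrix.diagonal_mul_diagonal, Matrix.trace_diagonal,
    eigsDesc, tailSum_sortDesc_eq, Complex.re_sum]
  refine Finset.sum_congr rfl fun i _ => ?_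
  simp only [hs]
  split_ifs <;> simp

end KyFan

section Lipschitz

variable {n m : ℕ}

attribute [local instance] Matrix.frobeniusNormedAddCommGroup Matrix.frobeniusNormedSpace

theorem frobenius_norm_sq (X : Matrix (Fin n) (Fin m) ℂ) : ‖X‖ ^ 2 = ∑ i, ∑ j, ‖X i j‖ ^ 2 := by
  have h : 0 ≤ ∑ i, ∑ j, ‖X i j‖ ^ 2 :=
    Finset.sum_nonneg fun _ _ => Finset.sum_nonneg fun _ _ => sq_nonneg _
  rw [Matrix.frobenius_norm_def, ← Real.sqrt_eq_rpow]
  simp only [Real.rpow_ofNat]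
  rw [Real.sq_sqrt h]

theorem frobenius_norm_sq_eq_trace (X : Matrix (Fin n) (Fin m) ℂ) :
    ‖X‖ ^ 2 = (X * X.conjTranspose).trace.re := by
  rw [frobenius_norm_sq, trace_mul_eq_sum]
  simp only [Matrix.conjTranspose_apply, Complex.star_def, Complex.mul_conj', Complex.re_sum]
  norm_cast

theorem IsRankProjection.norm_mul_sq {P : Matrix (Fin n) (Fin n) ℂ} {r : ℕ}
    (hP : IsRankProjection P r) (X : Matrix (Fin n) (Fin m) ℂ) :
    ‖P * X‖ ^ 2 = (P * (X * X.conjTranspose)).trace.re := by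
  rw [frobenius_norm_sq_eq_trace, Matrix.conjTranspose_mul, hP.conjTranspose, ← Matrix.mul_assoc,
    Matrix.trace_mul_comm, ← Matrix.mul_assoc, ← Matrix.mul_assoc, hP.mul_self, Matrix.mul_assoc]

theorem IsRankProjection.norm_mul_le {P : Matrix (Fin n) (Fin n) ℂ} {r : ℕ}
    (hP : IsRankProjection P r) (X : Matrix (Fin n) (Fin m) ℂ) : ‖P * X‖ ≤ ‖X‖ := by
  refine le_of_sq_le_sq ?_ (norm_nonneg _)
  have h : ‖X - P * X‖ ^ 2 = ‖X‖ ^ 2 - ‖P * X‖ ^ 2 := by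
    rw [hP.norm_mul_sq, frobenius_norm_sq_eq_trace, frobenius_norm_sq_eq_trace,
      ← Complex.sub_re, ← Matrix.trace_sub]
    have e : (X - P * X) * (X - P * X).conjTranspose =
        X * X.conjTranspose - P * (X * X.conjTranspose) - (X * X.conjTranspose * P -
          P * (X * X.conjTranspose) * P) := by
      rw [Matrix.conjTranspose_sub, Matrix.conjTranspose_mul, hP.conjTranspose]
      simp only [Matrix.sub_mul, Matrix.mul_sub, Matrix.mul_assoc]
    have e2 : (X * X.conjTranspose * P - P * (X * X.conjTranspose) * P).trace = 0 := by
      rw [Matrix.trace_sub, Matrix.trace_mul_comm (P * (X * X.conjTranspose)), ← Matrix.mul_assoc,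
        hP.mul_self, Matrix.trace_mul_comm P, sub_self]
    rw [e, Matrix.trace_sub, e2, sub_zero]
  linarith [sq_nonneg ‖X - P * X‖]

/-- The square root of a tail sum of the squared singular values of `G`. -/
def tailNorm (G : Matrix (Fin n) (Fin m) ℂ) (k : Fin n) : ℝ :=
  √(tailSum (eigsDesc (G * G.conjTranspose)) k)

theorem tailSum_eigsDesc_nonneg (G : Matrix (Fin n) (Fin m) ℂ) (k : Fin n) :
    0 ≤ tailSum (eigsDesc (G * G.conjTranspose)) k :=
  le_tailSum_sortDesc le_rfl (eigs_mul_conjTranspose_nonneg G) k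

theorem tailNorm_le_norm_mul (G : Matrix (Fin n) (Fin m) ℂ) {k : Fin n}
    {P : Matrix (Fin n) (Fin n) ℂ} (hP : IsRankProjection P (n - k)) :
    tailNorm G k ≤ ‖P * G‖ := by
  refine (Real.sqrt_le_left (norm_nonneg _)).2 ?_
  rw [hP.norm_mul_sq]
  exact tailSum_eigsDesc_le (Matrix.isHermitian_mul_conjTranspose_self G) hP

theorem exists_norm_mul_eq_tailNorm (G : Matrix (Fin n) (Fin m) ℂ) (k : Fin n) :
    ∃ P : Matrix (Fin n) (Fin n) ℂ, IsRankProjection P (n - k) ∧ ‖P * G‖ = tailNorm G k := by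
  obtain ⟨P, hP, h⟩ := exists_tailSum_eigsDesc_eq (Matrix.isHermitian_mul_conjTranspose_self G) k
  refine ⟨P, hP, ?_⟩
  rw [tailNorm, ← h, ← hP.norm_mul_sq, Real.sqrt_sq (norm_nonneg _)]

theorem tailNorm_sub_le (G H : Matrix (Fin n) (Fin m) ℂ) (k : Fin n) :
    tailNorm G k - tailNorm H k ≤ ‖G - H‖ := by
  obtain ⟨P, hP, h⟩ := exists_norm_mul_eq_tailNorm H k
  have h1 := tailNorm_le_norm_mul G hP
  have h2 := hP.norm_mul_le (G - H)
  rw [Matrix.mul_sub] at h2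
  have h3 := norm_sub_norm_le (P * G) (P * H)
  linarith

theorem sq_tailNorm_sub_le (G H : Matrix (Fin n) (Fin m) ℂ) (k : Fin n) :
    (tailNorm G k - tailNorm H k) ^ 2 ≤ ∑ i, ∑ j, ‖G i j - H i j‖ ^ 2 := by
  have h := frobenius_norm_sq (G - H)
  simp only [Matrix.sub_apply] at h
  rw [← h, sq_le_sq, abs_norm, abs_le]
  have h1 := tailNorm_sub_le G H k
  have h2 := tailNorm_sub_le H G k
  rw [norm_sub_rev] at h2
  constructor <;> linarith

end Lipschitz

section Scaling

variable {n : ℕ}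

theorem tailSum_eigsDesc_smul {A : Matrix (Fin n) (Fin n) ℂ} (hA : A.IsHermitian) {c : ℝ}
    (hc : 0 ≤ c) (k : Fin n) :
    tailSum (eigsDesc ((c : ℂ) • A)) k = c * tailSum (eigsDesc A) k := by
  have hcA : ((c : ℂ) • A).IsHermitian := by
    rw [Matrix.IsHermitian, Matrix.conjTranspose_smul, hA.eq, Complex.star_def, Complex.conj_ofReal]
  have htr : ∀ P : Matrix (Fin n) (Fin n) ℂ,
      (P * ((c : ℂ) • A)).trace.re = c * (P * A).trace.re := by
    intro P
    rw [Matrix.mul_smul, Matrix.trace_smul, smul_eq_mul, Complex.re_ofReal_mul]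
  apply le_antisymm
  · obtain ⟨P, hP, h⟩ := exists_tailSum_eigsDesc_eq hA k
    rw [← h, ← htr]
    exact tailSum_eigsDesc_le hcA hP
  · obtain ⟨P, hP, h⟩ := exists_tailSum_eigsDesc_eq hcA k
    rw [← h, htr]
    exact mul_le_mul_of_nonneg_left (tailSum_eigsDesc_le hA hP) hc

theorem trace_eq_tailSum_eigsDesc {A : Matrix (Fin n) (Fin n) ℂ} (hA : A.IsHermitian) {k : Fin n}
    (hk : ∀ i, k ≤ i) : A.trace = (tailSum (eigsDesc A) k : ℂ) := by
  rw [eigsDesc, tailSum_sortDesc_zero _ _ hk, eigs, dif_pos hA, hA.trace_eq_sum_eigenvalues]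
  push_cast
  rfl

theorem measurable_tailSum_eigsDesc (k : Fin n) :
    Measurable fun A : Matrix (Fin n) (Fin n) ℂ => tailSum (eigsDesc A) k := by
  have hH : MeasurableSet {A : Matrix (Fin n) (Fin n) ℂ | A.IsHermitian} :=
    (isClosed_eq continuous_id.matrix_conjTranspose continuous_id).measurableSet
  refine measurable_of_Iio fun c => ?_
  have e : (fun A : Matrix (Fin n) (Fin n) ℂ => tailSum (eigsDesc A) k) ⁻¹' Set.Iio c =
      ({A | A.IsHermitian} ∩ ⋃ P ∈ {P | IsRankProjection P (n - k)},
        {A : Matrix (Fin n) (Fin n) ℂ | (P * A).trace.re < c}) ∪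
      ({A | A.IsHermitian}ᶜ ∩ {_A | 0 < c}) := by
    ext A
    by_cases hA : A.IsHermitian
    · simp only [Set.mem_preimage, Set.mem_Iio, Set.mem_union, Set.mem_inter_iff, Set.mem_ofPred_eq,
        hA, true_and, Set.mem_compl_iff, not_true_eq_false, false_and, or_false, Set.mem_iUnion,
        exists_prop]
      constructor
      · intro h
        obtain ⟨P, hP, h2⟩ := exists_tailSum_eigsDesc_eq hA k
        exact ⟨P, hP, h2 ▸ h⟩
      · rintro ⟨P, hP, h⟩
        exact (tailSum_eigsDesc_le hA hP).trans_lt h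
    · have h0 : tailSum (eigsDesc A) k = 0 := by
        rw [eigsDesc, eigs, dif_neg hA, sortDesc_zero]
        simp [tailSum]
      simp [hA, h0]
  rw [e]
  refine (hH.inter (IsOpen.measurableSet ?_)).union (hH.compl.inter (MeasurableSet.const _))
  refine isOpen_biUnion fun P _ => isOpen_lt ?_ continuous_const
  exact Complex.continuous_re.comp (continuous_const.matrix_mul continuous_id).matrix_trace

end Scaling

section UniformConcentration

variable {Ω ι : Type*} [MeasurableSpace Ω] {μ : Measure Ω} [IsProbabilityMeasure μ] [Fintype ι]
  [LinearOrder ι] {f : ι → Ω → ℝ} {η : ℝ}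

theorem measure_block_le (hf : ∀ k, MemLp (f k) 2 μ) (hv : ∀ k, Var[f k; μ] ≤ 1)
    (hanti : ∀ ω, Antitone fun k => f k ω) (hη : 0 < η) (hη1 : η ≤ 1) {b : ℝ} (hb : 0 < b) :
    μ {ω | ∃ k, (b ≤ μ[f k] ∧ μ[f k] < (1 + η / 3) * b) ∧ η * μ[f k] < |f k ω - μ[f k]|} ≤
      ENNReal.ofReal (18 / (η ^ 2 * b ^ 2)) := by
  classical
  set S : Finset ι := Finset.univ.filter fun k => b ≤ μ[f k] ∧ μ[f k] < (1 + η / 3) * b with hS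
  have hmem : ∀ k, k ∈ S ↔ b ≤ μ[f k] ∧ μ[f k] < (1 + η / 3) * b := by simp [hS]
  rcases S.eq_empty_or_nonempty with hS0 | hS0
  · have : {ω | ∃ k, (b ≤ μ[f k] ∧ μ[f k] < (1 + η / 3) * b) ∧
        η * μ[f k] < |f k ω - μ[f k]|} = ∅ := by
      refine Set.eq_empty_of_forall_notMem ?_
      rintro ω ⟨k, hk, -⟩
      simpa [hS0] using (hmem k).2 hk
    rw [this, measure_empty]
    exact zero_le
  have cheb : ∀ k ∈ S, μ {ω | η / 3 * μ[f k] ≤ |f k ω - μ[f k]|} ≤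
      ENNReal.ofReal (9 / (η ^ 2 * b ^ 2)) := by
    intro k hk
    have hbk := ((hmem k).1 hk).1
    refine (meas_ge_le_variance_div_sq (hf k)
      (mul_pos (by positivity) (hb.trans_le hbk))).trans
      (ENNReal.ofReal_le_ofReal ?_)
    calc Var[f k; μ] / (η / 3 * μ[f k]) ^ 2 ≤ 1 / (η / 3 * b) ^ 2 := by
          gcongr
          exact hv k
      _ = 9 / (η ^ 2 * b ^ 2) := by field_simp; norm_num
  have hlo := S.min'_mem hS0
  have hhi := S.max'_mem hS0
  have hsub : {ω | ∃ k, (b ≤ μ[f k] ∧ μ[f k] < (1 + η / 3) * b) ∧ η * μ[f k] < |f k ω - μ[f k]|} ⊆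
      {ω | η / 3 * μ[f (S.min' hS0)] ≤ |f (S.min' hS0) ω - μ[f (S.min' hS0)]|} ∪
      {ω | η / 3 * μ[f (S.max' hS0)] ≤ |f (S.max' hS0) ω - μ[f (S.max' hS0)]|} := by
    rintro ω ⟨k, hk, hbad⟩
    by_contra hcon
    rw [Set.mem_union, not_or] at hcon
    simp only [Set.mem_ofPred_eq, not_le] at hcon
    obtain ⟨h1, h2⟩ := hcon
    have h3 : f k ω ≤ f (S.min' hS0) ω := hanti ω (S.min'_le k ((hmem k).2 hk))
    have h4 : f (S.max' hS0) ω ≤ f k ω := hanti ω (S.le_max' k ((hmem k).2 hk))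
    have h5 := (hmem _).1 hlo
    have h6 := (hmem _).1 hhi
    rw [abs_lt] at h1 h2
    refine absurd hbad (not_lt.2 (abs_le.2 ⟨?_, ?_⟩))
    · have h7 : (1 - η) * μ[f k] ≤ (1 - η) * ((1 + η / 3) * b) :=
        mul_le_mul_of_nonneg_left hk.2.le (by linarith)
      have h8 : (1 - η / 3) * b ≤ (1 - η / 3) * μ[f (S.max' hS0)] :=
        mul_le_mul_of_nonneg_left h6.1 (by linarith)
      nlinarith [mul_pos (mul_pos hη hη) hb, mul_pos hη hb]
    · have h7 : (1 + η) * b ≤ (1 + η) * μ[f k] :=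
        mul_le_mul_of_nonneg_left hk.1 (by linarith)
      have h8 : (1 + η / 3) * μ[f (S.min' hS0)] ≤ (1 + η / 3) * ((1 + η / 3) * b) :=
        mul_le_mul_of_nonneg_left h5.2.le (by linarith)
      have h9 : η * (η * b) ≤ η * b := by
        have := mul_le_mul_of_nonneg_right hη1 (mul_pos hη hb).le
        linarith
      nlinarith
  refine (measure_mono hsub).trans ((measure_union_le _ _).trans
    ((add_le_add (cheb _ hlo) (cheb _ hhi)).trans_eq ?_))
  rw [← ENNReal.ofReal_add (by positivity) (by positivity)]
  congr 1
  ring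

/-- Simultaneous relative concentration of a decreasing family of random variables with bounded
variances and large means. -/
theorem measure_exists_lt_abs_sub_le (hf : ∀ k, MemLp (f k) 2 μ) (hv : ∀ k, Var[f k; μ] ≤ 1)
    (hanti : ∀ ω, Antitone fun k => f k ω) (hη : 0 < η) (hη1 : η ≤ 1) {L : ℝ} (hL : 0 < L)
    (hfL : ∀ k, L ≤ μ[f k]) :
    μ {ω | ∃ k, η * μ[f k] < |f k ω - μ[f k]|} ≤
      ENNReal.ofReal (18 / η ^ 2 * (1 - ((1 + η / 3) ^ 2)⁻¹)⁻¹ / L ^ 2) := by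
  set q := 1 + η / 3 with hq
  have hq1 : 1 < q := by linarith
  have hr0 : 0 ≤ (q ^ 2)⁻¹ := by positivity
  have hr1 : (q ^ 2)⁻¹ < 1 := inv_lt_one_of_one_lt₀ (one_lt_pow₀ hq1 two_ne_zero)
  have hsub : {ω | ∃ k, η * μ[f k] < |f k ω - μ[f k]|} ⊆ ⋃ i : ℕ,
      {ω | ∃ k, (L * q ^ i ≤ μ[f k] ∧ μ[f k] < q * (L * q ^ i)) ∧
        η * μ[f k] < |f k ω - μ[f k]|} := by
    rintro ω ⟨k, hk⟩
    obtain ⟨i, hi1, hi2⟩ := exists_nat_pow_near ((one_le_div hL).2 (hfL k)) hq1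
    rw [le_div_iff₀ hL] at hi1
    rw [div_lt_iff₀ hL, pow_succ] at hi2
    exact Set.mem_iUnion.2 ⟨i, k, ⟨by linarith, by linarith⟩, hk⟩
  calc _ ≤ ∑' i : ℕ, ENNReal.ofReal (18 / (η ^ 2 * (L * q ^ i) ^ 2)) :=
        (measure_mono hsub).trans ((measure_iUnion_le _).trans
          (ENNReal.tsum_le_tsum fun i => measure_block_le hf hv hanti hη hη1 (by positivity)))
    _ = ∑' i : ℕ, ENNReal.ofReal (18 / η ^ 2 / L ^ 2 * ((q ^ 2)⁻¹) ^ i) := by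
        congr 1
        ext i
        congr 1
        rw [inv_pow, ← pow_mul, mul_comm 2 i, pow_mul]
        field_simp
    _ = ENNReal.ofReal (∑' i : ℕ, 18 / η ^ 2 / L ^ 2 * ((q ^ 2)⁻¹) ^ i) :=
        (ENNReal.ofReal_tsum_of_nonneg (fun i => by positivity)
          ((summable_geometric_of_lt_one hr0 hr1).mul_left _)).symm
    _ = _ := by
        rw [tsum_mul_left, tsum_geometric_of_lt_one hr0 hr1]
        congr 1
        ring

end UniformConcentration

section WishartConcentration

variable {n m : ℕ}

theorem measurable_mul_conjTranspose :
    Measurable fun G : Matrix (Fin n) (Fin m) ℂ => G * G.conjTranspose :=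
  (continuous_id.matrix_mul continuous_id.matrix_conjTranspose).measurable

theorem measurable_tailNorm (k : Fin n) :
    Measurable fun G : Matrix (Fin n) (Fin m) ℂ => tailNorm G k :=
  ((measurable_tailSum_eigsDesc k).comp measurable_mul_conjTranspose).sqrt

theorem memLp_tailNorm (k : Fin n) :
    MemLp (fun G : Matrix (Fin n) (Fin m) ℂ => tailNorm G k) 2 (gaussMatrix n m) :=
  memLp_two_gaussMatrix (measurable_tailNorm k) fun G H => sq_tailNorm_sub_le G H k

theorem variance_tailNorm_le (k : Fin n) :
    Var[fun G : Matrix (Fin n) (Fin m) ℂ => tailNorm G k; gaussMatrix n m] ≤ 1 :=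
  variance_gaussMatrix_le (measurable_tailNorm k) fun G H => sq_tailNorm_sub_le G H k

theorem tailNorm_antitone (G : Matrix (Fin n) (Fin m) ℂ) : Antitone fun k => tailNorm G k :=
  fun _ _ hkl => Real.sqrt_le_sqrt (tailSum_sortDesc_anti (eigs_mul_conjTranspose_nonneg G) hkl)

theorem le_integral_tailNorm {L : ℝ} (hL : 0 ≤ L)
    (hm : (n : ℝ) + 24 * (4 * L ^ 2 + 1) * Real.exp 2 * √(n * Real.log n) ≤ m)
    (hn : 24 * (4 * L ^ 2 + 1) * Real.exp 2 ≤ n) (k : Fin n) :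
    L ≤ ∫ G, tailNorm G k ∂gaussMatrix n m := by
  obtain ⟨S, -, hS, hSe⟩ := exists_eigs_lower_bound (by nlinarith [sq_nonneg L]) hm hn
  have h := mul_meas_ge_le_integral_of_nonneg (μ := gaussMatrix n m)
    (f := fun G => tailNorm G k) (.of_forall fun G => Real.sqrt_nonneg _)
    ((memLp_tailNorm k).integrable (by norm_num)) (2 * L)
  have hsub : S ⊆ {G | 2 * L ≤ tailNorm G k} := by
    intro G hG
    refine Real.le_sqrt_of_sq_le (le_tailSum_sortDesc (by positivity) (fun i => ?_) k)
    linarith [hSe G hG i]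
  have h2 := hS.trans (measureReal_mono (μ := gaussMatrix n m) hsub)
  have h3 := mul_le_mul_of_nonneg_left h2 (by linarith : 0 ≤ 2 * L)
  linarith

theorem measurable_normalise :
    Measurable fun M : Matrix (Fin n) (Fin n) ℂ => (Matrix.trace M)⁻¹ • M := by
  refine measurable_pi_iff.2 fun i => measurable_pi_iff.2 fun j => ?_
  have h1 : Measurable fun M : Matrix (Fin n) (Fin n) ℂ => Matrix.trace M :=
    continuous_id.matrix_trace.measurable
  have h2 : Measurable fun M : Matrix (Fin n) (Fin n) ℂ => M i j :=
    (continuous_id.matrix_elem i j).measurable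
  exact h1.inv.mul h2

theorem wishartNorm_apply {B : Set (Matrix (Fin n) (Fin n) ℂ)} (hB : MeasurableSet B) :
    wishartNorm n m B = gaussMatrix n m {G | (Matrix.trace (G * G.conjTranspose))⁻¹ •
      (G * G.conjTranspose) ∈ B} := by
  rw [wishartNorm, wishart, Measure.map_apply measurable_normalise hB,
    Measure.map_apply measurable_mul_conjTranspose (measurable_normalise hB)]
  rfl

instance : IsProbabilityMeasure (wishartNorm n m) := by
  have : IsProbabilityMeasure (wishart n m) :=
    Measure.isProbabilityMeasure_map measurable_mul_conjTranspose.aemeasurable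
  exact Measure.isProbabilityMeasure_map measurable_normalise.aemeasurable

theorem tailSum_normalise {k₀ : Fin n} (hk₀ : ∀ i, k₀ ≤ i) (G : Matrix (Fin n) (Fin m) ℂ)
    (k : Fin n) :
    tailSum (eigsDesc ((Matrix.trace (G * G.conjTranspose))⁻¹ • (G * G.conjTranspose))) k =
      tailNorm G k ^ 2 / tailNorm G k₀ ^ 2 := by
  have hH := Matrix.isHermitian_mul_conjTranspose_self G
  rw [trace_eq_tailSum_eigsDesc hH hk₀, ← Complex.ofReal_inv,
    tailSum_eigsDesc_smul hH (inv_nonneg.2 (tailSum_eigsDesc_nonneg G k₀)), tailNorm, tailNorm,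
    Real.sq_sqrt (tailSum_eigsDesc_nonneg G k), Real.sq_sqrt (tailSum_eigsDesc_nonneg G k₀),
    inv_mul_eq_div]

/-- Trace-normalised matrices whose tail sums are comparable to reference values. -/
def comparableTails (a : Fin n → ℝ) (r : ℝ) : Set (Matrix (Fin n) (Fin n) ℂ) :=
  {M | ∀ k, r * a k ≤ tailSum (eigsDesc M) k ∧ tailSum (eigsDesc M) k ≤ r⁻¹ * a k}

theorem measurableSet_comparableTails (a : Fin n → ℝ) (r : ℝ) :
    MeasurableSet (comparableTails a r) := by
  have : comparableTails a r = ⋂ k, {M | r * a k ≤ tailSum (eigsDesc M) k} ∩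
      {M | tailSum (eigsDesc M) k ≤ r⁻¹ * a k} := by
    ext M
    simp [comparableTails]
  rw [this]
  exact MeasurableSet.iInter fun k =>
    (measurableSet_le measurable_const (measurable_tailSum_eigsDesc k)).inter
      (measurableSet_le (measurable_tailSum_eigsDesc k) measurable_const)

theorem le_PiRatio [Nonempty (Fin n)] {a : Fin n → ℝ} {r : ℝ} (hr : 0 < r) (ha : ∀ k, 0 < a k)
    {M₁ M₂ : Matrix (Fin n) (Fin n) ℂ} (h₁ : M₁ ∈ comparableTails a r)
    (h₂ : M₂ ∈ comparableTails a r) : r ^ 2 ≤ PiRatio M₁ M₂ := by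
  refine le_ciInf fun k => ?_
  have h3 := ha k
  have h4 : 0 < tailSum (eigsDesc M₂) k := (mul_pos hr (ha k)).trans_le (h₂ k).1
  rw [le_div_iff₀ h4]
  calc r ^ 2 * tailSum (eigsDesc M₂) k ≤ r ^ 2 * (r⁻¹ * a k) :=
        mul_le_mul_of_nonneg_left (h₂ k).2 (by positivity)
    _ = r * a k := by field_simp
    _ ≤ _ := (h₁ k).1

theorem sq_div_sq_bounds {η x y s t : ℝ} (hη : 0 < η) (hη1 : η < 1) (hx : 0 < x) (hy : 0 < y)
    (h₁ : (1 - η) * x ≤ s) (h₂ : s ≤ (1 + η) * x) (h₃ : (1 - η) * y ≤ t) (h₄ : t ≤ (1 + η) * y) :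
    ((1 - η) / (1 + η)) ^ 2 * (x ^ 2 / y ^ 2) ≤ s ^ 2 / t ^ 2 ∧
      s ^ 2 / t ^ 2 ≤ (((1 - η) / (1 + η)) ^ 2)⁻¹ * (x ^ 2 / y ^ 2) := by
  have hη' : 0 < 1 - η := by linarith
  have hs : 0 < s := (mul_pos hη' hx).trans_le h₁
  have ht : 0 < t := (mul_pos hη' hy).trans_le h₃
  constructor
  · calc ((1 - η) / (1 + η)) ^ 2 * (x ^ 2 / y ^ 2) = ((1 - η) * x) ^ 2 / ((1 + η) * y) ^ 2 := by
          field_simp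
      _ ≤ s ^ 2 / t ^ 2 := by gcongr
  · calc s ^ 2 / t ^ 2 ≤ ((1 + η) * x) ^ 2 / ((1 - η) * y) ^ 2 := by gcongr
      _ = (((1 - η) / (1 + η)) ^ 2)⁻¹ * (x ^ 2 / y ^ 2) := by field_simp

theorem wishartNorm_compl_comparableTails_le {k₀ : Fin n} (hk₀ : ∀ i, k₀ ≤ i) {η L : ℝ}
    (hη : 0 < η) (hη1 : η < 1) (hL : 0 < L)
    (ha : ∀ k, L ≤ ∫ G, tailNorm G k ∂gaussMatrix n m) :
    wishartNorm n m (comparableTails (fun k => (∫ G, tailNorm G k ∂gaussMatrix n m) ^ 2 /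
      (∫ G, tailNorm G k₀ ∂gaussMatrix n m) ^ 2) (((1 - η) / (1 + η)) ^ 2))ᶜ ≤
      ENNReal.ofReal (18 / η ^ 2 * (1 - ((1 + η / 3) ^ 2)⁻¹)⁻¹ / L ^ 2) := by
  rw [wishartNorm_apply (measurableSet_comparableTails _ _).compl]
  refine le_trans (measure_mono ?_) (measure_exists_lt_abs_sub_le
    (f := fun k (G : Matrix (Fin n) (Fin m) ℂ) => tailNorm G k) memLp_tailNorm
    variance_tailNorm_le tailNorm_antitone hη hη1.le hL ha)
  intro G hG
  by_contra hcon
  refine hG fun k => ?_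
  simp only [Set.mem_ofPred_eq, not_exists, not_lt] at hcon
  have hk := abs_le.1 (hcon k)
  have h0 := abs_le.1 (hcon k₀)
  rw [tailSum_normalise hk₀]
  have hak := hL.trans_le (ha k)
  have ha0 := hL.trans_le (ha k₀)
  set x := ∫ G, tailNorm G k ∂gaussMatrix n m
  set y := ∫ G, tailNorm G k₀ ∂gaussMatrix n m
  have h1η : 0 < 1 - η := by linarith
  have hk1 : (1 - η) * x ≤ tailNorm G k := by linarith
  have hk2 : tailNorm G k ≤ (1 + η) * x := by linarith
  have h01 : (1 - η) * y ≤ tailNorm G k₀ := by linarith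
  have h02 : tailNorm G k₀ ≤ (1 + η) * y := by linarith
  exact sq_div_sq_bounds hη hη1 hak ha0 hk1 hk2 h01 h02

end WishartConcentration

/-- Theorem 5.1 of the paper (quantitative approximate LOCC-convertibility): for every
`ε, δ > 0` there is `C(ε,δ) > 0` such that if `m ≥ n + C√(n log n)` and `n ≥ C`, then
`P[Π < 1 − ε] ≤ δ`. -/
theorem approximate_conversion_quantitative (ε δ : ℝ) (hε : 0 < ε) (hδ : 0 < δ) :
    ∃ C : ℝ, 0 < C ∧ ∀ n m : ℕ,
      (n : ℝ) + C * Real.sqrt (n * Real.log n) ≤ (m : ℝ) → C ≤ (n : ℝ) →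
      ((wishartNorm n m).prod (wishartNorm n m)) {p | PiRatio p.1 p.2 < 1 - ε}
        ≤ ENNReal.ofReal δ := by
  set η := min ε 1 / 8 with hη
  have hη0 : 0 < η := by positivity
  have hη1 : η ≤ 1 / 8 := by linarith [min_le_right ε 1]
  have hηε : 8 * η ≤ ε := by linarith [min_le_left ε 1]
  have hq : ((1 + η / 3) ^ 2)⁻¹ < 1 :=
    inv_lt_one_of_one_lt₀ (one_lt_pow₀ (by linarith) two_ne_zero)
  set κ := 18 / η ^ 2 * (1 - ((1 + η / 3) ^ 2)⁻¹)⁻¹ with hκ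
  have hκ0 : 0 < κ := mul_pos (by positivity) (inv_pos.2 (by linarith))
  set L := √(2 * κ / δ) with hLd
  have hL : 0 < L := Real.sqrt_pos.2 (by positivity)
  have hκL : κ / L ^ 2 = δ / 2 := by
    rw [hLd, Real.sq_sqrt (by positivity)]
    field_simp
  refine ⟨24 * (4 * L ^ 2 + 1) * Real.exp 2, by positivity, fun n m hm hn => ?_⟩
  have hn0 : 0 < n := by
    have : (0 : ℝ) < n := lt_of_lt_of_le (by positivity) hn
    exact_mod_cast this
  have : Nonempty (Fin n) := ⟨⟨0, hn0⟩⟩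
  have ha := le_integral_tailNorm (m := m) hL.le hm hn
  have hk₀ : ∀ i : Fin n, (⟨0, hn0⟩ : Fin n) ≤ i := fun i => Nat.zero_le _
  have hB := wishartNorm_compl_comparableTails_le hk₀ hη0 (by linarith) hL ha
  rw [← hκ, hκL] at hB
  set B := comparableTails (fun k => (∫ G, tailNorm G k ∂gaussMatrix n m) ^ 2 /
      (∫ G, tailNorm G (⟨0, hn0⟩ : Fin n) ∂gaussMatrix n m) ^ 2) (((1 - η) / (1 + η)) ^ 2)
  have hr : 0 < (1 - η) / (1 + η) := div_pos (by linarith) (by linarith)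
  have hrε : 1 - ε ≤ (((1 - η) / (1 + η)) ^ 2) ^ 2 := by
    have h1 : 1 + -2 * η ≤ (1 - η) / (1 + η) := by
      rw [le_div_iff₀ (by linarith)]
      nlinarith
    have h2 := one_add_mul_le_pow (a := -2 * η) (by linarith) 4
    have h3 := pow_le_pow_left₀ (by linarith) h1 4
    rw [← pow_mul]
    push_cast at h2
    linarith
  have hsub : {p : Matrix (Fin n) (Fin n) ℂ × Matrix (Fin n) (Fin n) ℂ | PiRatio p.1 p.2 < 1 - ε} ⊆
      Bᶜ ×ˢ Set.univ ∪ Set.univ ×ˢ Bᶜ := by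
    intro p hp
    by_contra hcon
    simp only [Set.mem_union, Set.mem_prod, Set.mem_compl_iff, Set.mem_univ, and_true, true_and,
      not_or, not_not] at hcon
    exact absurd (hrε.trans (le_PiRatio (pow_pos hr 2) (fun k => div_pos
      (pow_pos (hL.trans_le (ha k)) 2) (pow_pos (hL.trans_le (ha _)) 2)) hcon.1 hcon.2))
        (not_le.2 hp)
  calc _ ≤ ((wishartNorm n m).prod (wishartNorm n m)) (Bᶜ ×ˢ Set.univ) +
        ((wishartNorm n m).prod (wishartNorm n m)) (Set.univ ×ˢ Bᶜ) :=
        (measure_mono hsub).trans (measure_union_le _ _)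
    _ ≤ ENNReal.ofReal (δ / 2) + ENNReal.ofReal (δ / 2) := by
        rw [Measure.prod_prod, Measure.prod_prod, measure_univ, mul_one, one_mul]
        exact add_le_add hB hB
    _ = ENNReal.ofReal δ := by
        rw [← ENNReal.ofReal_add (by positivity) (by positivity), add_halves]
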